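/- arXiv:2510.14527 — 3 statements merged into one kernel-verified Lean document; each statement's English description precedes it below -/
import Mathlib

section
/- Let Ω ⊂ ℝ² be a Jordan domain with analytic boundary and let f⁰ : Ω̄ → ℝ be real analytic in the closed domain, satisfy the minimal surface equation (1+(f⁰_y)²)·f⁰_xx − 2·f⁰_x·f⁰_y·f⁰_xy + (1+(f⁰_x)²)·f⁰_yy = 0 on Ω̄, and satisfy f⁰_xx·f⁰_yy − (f⁰_xy)² ≠ 0 at every point of Ω̄. Then for every ε > 0 there is at most one function f : Ω̄ × [−ε, ε] → ℝ real analytic in the closed domain such that f(·,·,t) satisfies the Euclidean CRPC equation with parameter t on Ω for each t ∈ [−ε, ε], and f(x,y,t) = f⁰(x,y) whenever t = 0 or (x,y) ∈ ∂Ω. -/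
open Set Filter
open scoped BigOperators Topology

noncomputable section

/-- Partial derivative in the first variable. -/
def pdx (f : ℝ × ℝ → ℝ) (p : ℝ × ℝ) : ℝ := deriv (fun s : ℝ => f (s, p.2)) p.1

/-- Partial derivative in the second variable. -/
def pdy (f : ℝ × ℝ → ℝ) (p : ℝ × ℝ) : ℝ := deriv (fun s : ℝ => f (p.1, s)) p.2

/-- Second partial derivatives. -/
def fxx (f : ℝ × ℝ → ℝ) : ℝ × ℝ → ℝ := pdx (pdx f)
def fxy (f : ℝ × ℝ → ℝ) : ℝ × ℝ → ℝ := pdy (pdx f)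
def fyy (f : ℝ × ℝ → ℝ) : ℝ × ℝ → ℝ := pdy (pdy f)

/-- An analytic Jordan curve: image of a periodic injective real analytic map with
nowhere vanishing derivative. -/
def IsAnalyticJordanCurve {E : Type*} [NormedAddCommGroup E] [NormedSpace ℝ E]
    (Γ : Set E) : Prop :=
  ∃ (γ : ℝ → E) (T : ℝ), 0 < T ∧
    AnalyticOnNhd ℝ γ univ ∧
    (∀ s, γ (s + T) = γ s) ∧
    InjOn γ (Ico 0 T) ∧
    (∀ s, deriv γ s ≠ 0) ∧
    Γ = range γ

/-- A Jordan domain with analytic boundary. -/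
def IsAnalyticJordanDomain (Ω : Set (ℝ × ℝ)) : Prop :=
  IsOpen Ω ∧ Bornology.IsBounded Ω ∧ IsConnected Ω ∧ IsAnalyticJordanCurve (frontier Ω)

/-- `f` is real analytic in the closed set `s` : it agrees on `s` with a function
analytic on an open neighborhood of `s`. -/
def AnalyticOnClosed {E : Type*} [NormedAddCommGroup E] [NormedSpace ℝ E]
    (f : E → ℝ) (s : Set E) : Prop :=
  ∃ (U : Set E) (g : E → ℝ), IsOpen U ∧ s ⊆ U ∧ AnalyticOnNhd ℝ g U ∧ EqOn f g s

/-- The isotropic CRPC equation with parameter `t` at a point. -/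
def IsotropicCRPCAt (t : ℝ) (f : ℝ × ℝ → ℝ) (p : ℝ × ℝ) : Prop :=
  fxx f p + fyy f p = t * Real.sqrt ((fxy f p) ^ 2 - fxx f p * fyy f p)

/-- The Euclidean CRPC equation with parameter `t` at a point. -/
def EuclideanCRPCAt (t : ℝ) (f : ℝ × ℝ → ℝ) (p : ℝ × ℝ) : Prop :=
  (1 + (pdy f p) ^ 2) * fxx f p - 2 * pdx f p * pdy f p * fxy f p
      + (1 + (pdx f p) ^ 2) * fyy f p
    = t * Real.sqrt ((1 + (pdx f p) ^ 2 + (pdy f p) ^ 2)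
        * ((fxy f p) ^ 2 - fxx f p * fyy f p))

/-- Hölder condition with exponent 1/2 on a set. -/
def HolderHalfOn (g : ℝ × ℝ → ℝ) (s : Set (ℝ × ℝ)) : Prop :=
  ∃ C : ℝ, ∀ u ∈ s, ∀ v ∈ s, |g u - g v| ≤ C * ‖u - v‖ ^ ((1 : ℝ) / 2)

def C0norm (g : ℝ × ℝ → ℝ) (s : Set (ℝ × ℝ)) : ℝ := sSup ((fun p => |g p|) '' s)

def holderSemi (g : ℝ × ℝ → ℝ) (s : Set (ℝ × ℝ)) : ℝ :=
  sSup {r : ℝ | ∃ u ∈ s, ∃ v ∈ s, u ≠ v ∧ r = |g u - g v| / ‖u - v‖ ^ ((1 : ℝ) / 2)}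

/-- The `C^{1/2}` Hölder norm. -/
def ChalfNorm (g : ℝ × ℝ → ℝ) (s : Set (ℝ × ℝ)) : ℝ := C0norm g s + holderSemi g s

/-- The `C²` norm. -/
def C2norm (f : ℝ × ℝ → ℝ) (s : Set (ℝ × ℝ)) : ℝ :=
  C0norm f s + max (C0norm (pdx f) s) (C0norm (pdy f) s)
    + max (C0norm (fxx f) s) (max (C0norm (fxy f) s) (C0norm (fyy f) s))

/-- The `C^{2+1/2}` Hölder norm. -/
def C2halfNorm (f : ℝ × ℝ → ℝ) (s : Set (ℝ × ℝ)) : ℝ :=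
  C2norm f s + max (holderSemi (fxx f) s) (max (holderSemi (fxy f) s) (holderSemi (fyy f) s))

/-- Membership in the class `C^{1/2}` on `Ω̄`. -/
def IsCHalf (g : ℝ × ℝ → ℝ) (Ω : Set (ℝ × ℝ)) : Prop :=
  ContinuousOn g (closure Ω) ∧ HolderHalfOn g Ω

/-- Membership in the class `C^{2+1/2}` on `Ω̄`. -/
def IsC2Half (f : ℝ × ℝ → ℝ) (Ω : Set (ℝ × ℝ)) : Prop :=
  ContDiffOn ℝ 2 f Ω ∧
  ContinuousOn f (closure Ω) ∧ ContinuousOn (pdx f) (closure Ω) ∧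
  ContinuousOn (pdy f) (closure Ω) ∧ ContinuousOn (fxx f) (closure Ω) ∧
  ContinuousOn (fxy f) (closure Ω) ∧ ContinuousOn (fyy f) (closure Ω) ∧
  HolderHalfOn (fxx f) Ω ∧ HolderHalfOn (fxy f) Ω ∧ HolderHalfOn (fyy f) Ω

/-- `C^∞` up to the boundary. -/
def IsCInftyClosed (f : ℝ × ℝ → ℝ) (Ω : Set (ℝ × ℝ)) : Prop :=
  ContDiffOn ℝ (⊤ : ℕ∞) f Ω ∧ ∀ i j : ℕ, ContinuousOn (pdx^[i] (pdy^[j] f)) (closure Ω)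

/-- Right-hand side of the recursive Poisson equation (isotropic case). -/
def poissonRHS (f : ℕ → ℝ × ℝ → ℝ) (m : ℕ) (p : ℝ × ℝ) : ℝ :=
  ((m : ℝ) * ∑ r ∈ Finset.range m, ((m - 1).choose r : ℝ) *
      (fxy (f r) p * fxy (f (m - r - 1)) p - fxx (f r) p * fyy (f (m - r - 1)) p)
    - (1 / ((m : ℝ) + 1)) * ∑ r ∈ Finset.Icc 2 (m - 1), ((m + 1).choose r : ℝ) *
      (fxx (f r) p + fyy (f r) p) * (fxx (f (m - r + 1)) p + fyy (f (m - r + 1)) p))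
  / ((2 : ℝ) ^ (1 - (if m = 1 then 1 else 0) : ℕ) *
      Real.sqrt ((fxy (f 0) p) ^ 2 - fxx (f 0) p * fyy (f 0) p))

/-- `C²`-convergence on `Ω` at parameter `t` of the series with terms `f m · t^m/m!`
to the function `F`. -/
def C2ConvergesTo (f : ℕ → ℝ × ℝ → ℝ) (Ω : Set (ℝ × ℝ)) (t : ℝ) (F : ℝ × ℝ → ℝ) : Prop :=
  TendstoUniformlyOn
    (fun n p => ∑ m ∈ Finset.range n, f m p * t ^ m / (m.factorial : ℝ)) F atTop Ω ∧
  TendstoUniformlyOn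
    (fun n p => ∑ m ∈ Finset.range n, pdx (f m) p * t ^ m / (m.factorial : ℝ)) (pdx F) atTop Ω ∧
  TendstoUniformlyOn
    (fun n p => ∑ m ∈ Finset.range n, pdy (f m) p * t ^ m / (m.factorial : ℝ)) (pdy F) atTop Ω ∧
  TendstoUniformlyOn
    (fun n p => ∑ m ∈ Finset.range n, fxx (f m) p * t ^ m / (m.factorial : ℝ)) (fxx F) atTop Ω ∧
  TendstoUniformlyOn
    (fun n p => ∑ m ∈ Finset.range n, fxy (f m) p * t ^ m / (m.factorial : ℝ)) (fxy F) atTop Ω ∧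
  TendstoUniformlyOn
    (fun n p => ∑ m ∈ Finset.range n, fyy (f m) p * t ^ m / (m.factorial : ℝ)) (fyy F) atTop Ω


/-- `F` is a real analytic family of functions on `Ω̄ × [-ε, ε]`, coinciding with `f0`
for `t = 0` and on `∂Ω`, whose slice at parameter `t` satisfies the Euclidean CRPC
equation with parameter `t` on `Ω`. -/
def IsEuclideanCRPCFamily (Ω : Set (ℝ × ℝ)) (f0 : ℝ × ℝ → ℝ) (ε : ℝ)
    (F : (ℝ × ℝ) × ℝ → ℝ) : Prop :=
  AnalyticOnClosed F (closure Ω ×ˢ Icc (-ε) ε) ∧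
  (∀ p ∈ closure Ω, F (p, 0) = f0 p) ∧
  (∀ p ∈ frontier Ω, ∀ t ∈ Icc (-ε) ε, F (p, t) = f0 p) ∧
  (∀ t ∈ Icc (-ε) ε, ∀ p ∈ Ω, EuclideanCRPCAt t (fun q => F (q, t)) p)

/-! ### Helpers -/

/-- Ambient space. -/
abbrev E3 := (ℝ × ℝ) × ℝ

/-- Directional derivative. -/
def DD (e : E3) (f : E3 → ℝ) (q : E3) : ℝ := fderiv ℝ f q e

/-- Coordinate directions. -/
def ex : E3 := ((1, 0), 0)
def ey : E3 := ((0, 1), 0)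
def et : E3 := ((0, 0), 1)

lemma DD_analytic {f : E3 → ℝ} {U : Set E3} (hf : AnalyticOnNhd ℝ f U) (e : E3) :
    AnalyticOnNhd ℝ (DD e f) U := by
  intro q hq
  exact ((ContinuousLinearMap.apply ℝ ℝ e).analyticAt _).comp (hf q hq).fderiv

lemma DDt_analytic {f : E3 → ℝ} {U : Set E3} (hf : AnalyticOnNhd ℝ f U) (e : E3) (n : ℕ) :
    AnalyticOnNhd ℝ ((DD e)^[n] f) U := by
  induction n with
  | zero => exact hf
  | succ n ih => rw [Function.iterate_succ_apply']; exact DD_analytic ih e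

lemma DD_congr {f g : E3 → ℝ} {U : Set E3} (hU : IsOpen U) (h : EqOn f g U) (e : E3) :
    EqOn (DD e f) (DD e g) U := by
  intro q hq
  have : f =ᶠ[𝓝 q] g := h.eventuallyEq_of_mem (hU.mem_nhds hq)
  simp only [DD, this.fderiv_eq]

lemma DD_comm {f : E3 → ℝ} {U : Set E3} (hf : AnalyticOnNhd ℝ f U) (a b : E3) :
    EqOn (DD a (DD b f)) (DD b (DD a f)) U := by
  intro q hq
  have hs : IsSymmSndFDerivAt ℝ f q :=
    ((hf q hq).contDiffAt (n := ⊤)).isSymmSndFDerivAt (by simp)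
  have hd : DifferentiableAt ℝ (fderiv ℝ f) q := ((hf q hq).fderiv).differentiableAt
  have key : ∀ u v : E3, DD u (DD v f) q = fderiv ℝ (fderiv ℝ f) q u v := by
    intro u v
    have h1 := (ContinuousLinearMap.apply ℝ ℝ v).hasFDerivAt.comp q hd.hasFDerivAt
    have h2 : fderiv ℝ (DD v f) q = _ := h1.fderiv
    rw [DD, h2]
    rfl
  rw [key, key, hs]

lemma DDt_comm {f : E3 → ℝ} {U : Set E3} (hU : IsOpen U) (hf : AnalyticOnNhd ℝ f U) (a b : E3)
    (n : ℕ) : EqOn ((DD a)^[n] (DD b f)) (DD b ((DD a)^[n] f)) U := by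
  induction n with
  | zero => intro q _; rfl
  | succ n ih =>
    intro q hq
    rw [Function.iterate_succ_apply', Function.iterate_succ_apply']
    rw [DD_congr hU ih a hq]
    exact DD_comm (DDt_analytic hf a n) a b hq

lemma DD_sub {f g : E3 → ℝ} {U : Set E3} (hf : AnalyticOnNhd ℝ f U)
    (hg : AnalyticOnNhd ℝ g U) (e : E3) :
    EqOn (DD e (fun q => f q - g q)) (fun q => DD e f q - DD e g q) U := by
  intro q hq
  simp only [DD]
  rw [fderiv_fun_sub (hf q hq).differentiableAt (hg q hq).differentiableAt]
  rfl

lemma DD_neg (f : E3 → ℝ) (e : E3) :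
    DD e (fun q => - f q) = (fun q => - DD e f q) := by
  funext q
  simp only [DD]
  rw [fderiv_fun_neg]
  rfl

lemma hasDerivAt_line {f : E3 → ℝ} {q e : E3} {s : ℝ}
    (hf : DifferentiableAt ℝ f (q + s • e)) :
    HasDerivAt (fun s : ℝ => f (q + s • e)) (DD e f (q + s • e)) s := by
  have h : HasDerivAt (fun s : ℝ => q + s • e) e s := by
    simpa using ((hasDerivAt_id s).smul_const e).const_add q
  exact hf.hasFDerivAt.comp_hasDerivAt s h

lemma pdx_slice {g : ℝ × ℝ → ℝ} {f : E3 → ℝ} {U : Set E3} {Ω : Set (ℝ × ℝ)} {t : ℝ}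
    (hΩ : IsOpen Ω) (hf : AnalyticOnNhd ℝ f U) (hU : ∀ p ∈ Ω, (p, t) ∈ U)
    (h : ∀ p ∈ Ω, g p = f (p, t)) : ∀ p ∈ Ω, pdx g p = DD ex f (p, t) := by
  intro p hp
  have hc : HasDerivAt (fun s : ℝ => (((s, p.2), t) : E3)) ex p.1 :=
    ((hasDerivAt_id p.1).prodMk (hasDerivAt_const _ _)).prodMk (hasDerivAt_const _ _)
  have hd : HasDerivAt (fun s : ℝ => f ((s, p.2), t)) (DD ex f (p, t)) p.1 :=
    ((hf _ (hU p hp)).differentiableAt.hasFDerivAt).comp_hasDerivAt p.1 hc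
  have he : (fun s : ℝ => g (s, p.2)) =ᶠ[𝓝 p.1] (fun s : ℝ => f ((s, p.2), t)) := by
    have hcont : ContinuousAt (fun s : ℝ => ((s, p.2) : ℝ × ℝ)) p.1 := by fun_prop
    filter_upwards [hcont.preimage_mem_nhds (hΩ.mem_nhds hp)] with s hs using h _ hs
  unfold pdx
  rw [he.deriv_eq, hd.deriv]

lemma pdy_slice {g : ℝ × ℝ → ℝ} {f : E3 → ℝ} {U : Set E3} {Ω : Set (ℝ × ℝ)} {t : ℝ}
    (hΩ : IsOpen Ω) (hf : AnalyticOnNhd ℝ f U) (hU : ∀ p ∈ Ω, (p, t) ∈ U)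
    (h : ∀ p ∈ Ω, g p = f (p, t)) : ∀ p ∈ Ω, pdy g p = DD ey f (p, t) := by
  intro p hp
  have hc : HasDerivAt (fun s : ℝ => (((p.1, s), t) : E3)) ey p.2 :=
    ((hasDerivAt_const _ _).prodMk (hasDerivAt_id p.2)).prodMk (hasDerivAt_const _ _)
  have hd : HasDerivAt (fun s : ℝ => f ((p.1, s), t)) (DD ey f (p, t)) p.2 :=
    ((hf _ (hU p hp)).differentiableAt.hasFDerivAt).comp_hasDerivAt p.2 hc
  have he : (fun s : ℝ => g (p.1, s)) =ᶠ[𝓝 p.2] (fun s : ℝ => f ((p.1, s), t)) := by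
    have hcont : ContinuousAt (fun s : ℝ => ((p.1, s) : ℝ × ℝ)) p.2 := by fun_prop
    filter_upwards [hcont.preimage_mem_nhds (hΩ.mem_nhds hp)] with s hs using h _ hs
  unfold pdy
  rw [he.deriv_eq, hd.deriv]

/-- Iterated `t`-derivative along a vertical line. -/
lemma iter_t {f : E3 → ℝ} {U : Set E3} (hU : IsOpen U) (hf : AnalyticOnNhd ℝ f U) (p : ℝ × ℝ)
    (n : ℕ) : ∀ t, (p, t) ∈ U → iteratedDeriv n (fun t => f (p, t)) t = (DD et)^[n] f (p, t) := by
  induction n with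
  | zero => intro t _; simp
  | succ n ih =>
    intro t ht
    rw [iteratedDeriv_succ, Function.iterate_succ_apply']
    have hcont : ContinuousAt (fun s : ℝ => ((p, s) : E3)) t := by fun_prop
    have he : iteratedDeriv n (fun t => f (p, t)) =ᶠ[𝓝 t] fun t => (DD et)^[n] f (p, t) := by
      filter_upwards [hcont.preimage_mem_nhds (hU.mem_nhds ht)] with s hs using ih s hs
    rw [he.deriv_eq]
    have hc : HasDerivAt (fun s : ℝ => ((p, s) : E3)) et t :=
      (hasDerivAt_const t p).prodMk (hasDerivAt_id t)
    exact (((DDt_analytic hf et n) _ ht).differentiableAt.hasFDerivAt.comp_hasDerivAt t hc).deriv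

lemma DD_lin (a b : ℝ) (u v : E3) (f : E3 → ℝ) :
    DD (a • u + b • v) f = fun q => a * DD u f q + b * DD v f q := by
  funext q; simp [DD]

lemma DD_add_mul {f g : E3 → ℝ} {q : E3} (hf : AnalyticAt ℝ f q) (hg : AnalyticAt ℝ g q)
    (a b : ℝ) (e : E3) :
    DD e (fun q => a * f q + b * g q) q = a * DD e f q + b * DD e g q := by
  simp only [DD]
  rw [fderiv_fun_add (hf.differentiableAt.const_mul a) (hg.differentiableAt.const_mul b),
    fderiv_const_mul hf.differentiableAt, fderiv_const_mul hg.differentiableAt]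
  rfl

/-- Second derivative is nonpositive at a local max. -/
lemma snd_deriv_nonpos {φ : ℝ → ℝ} {a : ℝ} (hφ : AnalyticAt ℝ φ a) (hm : IsLocalMax φ a) :
    deriv (deriv φ) a ≤ 0 := by
  by_contra hlt
  push Not at hlt
  have hmin := isLocalMin_of_deriv_deriv_pos hlt hm.deriv_eq_zero hφ.continuousAt
  have hc : φ =ᶠ[𝓝 a] fun _ => φ a := by
    filter_upwards [hm, hmin] with s h1 h2 using le_antisymm h1 h2
  have h2 : deriv φ =ᶠ[𝓝 a] deriv (fun _ => φ a) := hc.deriv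
  rw [h2.deriv_eq] at hlt
  simp at hlt

lemma line_max {f : E3 → ℝ} {U : Set E3} (hU : IsOpen U) (hf : AnalyticOnNhd ℝ f U)
    {Ω : Set (ℝ × ℝ)} (hΩ : IsOpen Ω) {p : ℝ × ℝ} (hp : p ∈ Ω) (hpU : (p, (0 : ℝ)) ∈ U)
    (hm : ∀ p' ∈ Ω, f (p', 0) ≤ f (p, 0)) (v : ℝ × ℝ) :
    DD (v, 0) f (p, 0) = 0 ∧ DD (v, 0) (DD (v, 0) f) (p, 0) ≤ 0 := by
  set φ : ℝ → ℝ := fun s => f ((p, 0) + s • (v, 0)) with hφ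
  have hcont : ContinuousAt (fun s : ℝ => ((p, 0) + s • (v, 0) : E3)) 0 := by fun_prop
  have hin : ∀ᶠ s in 𝓝 (0 : ℝ), ((p, 0) + s • (v, 0) : E3) ∈ U :=
    hcont.preimage_mem_nhds (hU.mem_nhds (by simpa using hpU))
  have hcont' : ContinuousAt (fun s : ℝ => (p + s • v : ℝ × ℝ)) 0 := by fun_prop
  have hmax : IsLocalMax φ 0 := by
    filter_upwards [hcont'.preimage_mem_nhds (hΩ.mem_nhds (by simpa using hp))] with s hs
    have := hm _ hs
    simpa [hφ] using this
  have han : AnalyticAt ℝ φ 0 := by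
    have h1 : AnalyticAt ℝ f ((p, 0) + (0 : ℝ) • (v, 0)) := hf _ (by simpa using hpU)
    refine AnalyticAt.fun_comp (g := f) (f := fun s : ℝ => ((p, 0) + s • (v, 0) : E3)) h1 ?_
    exact analyticAt_const.add (analyticAt_id.smul analyticAt_const)
  have hd : deriv φ =ᶠ[𝓝 0] fun s => DD (v, 0) f ((p, 0) + s • (v, 0)) := by
    filter_upwards [hin] with s hs
    exact (hasDerivAt_line (hf _ hs).differentiableAt).deriv
  refine ⟨?_, ?_⟩
  · have := hmax.deriv_eq_zero
    rw [hd.self_of_nhds] at this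
    simpa using this
  · have := snd_deriv_nonpos han hmax
    rw [hd.deriv_eq, (hasDerivAt_line ((DD_analytic hf _) _ (hin.self_of_nhds)).differentiableAt).deriv] at this
    simpa using this

lemma max_principle {f : E3 → ℝ} {U : Set E3} (hU : IsOpen U) (hf : AnalyticOnNhd ℝ f U)
    {Ω : Set (ℝ × ℝ)} (hΩ : IsOpen Ω) (hb : Bornology.IsBounded Ω)
    (hsub : ∀ p ∈ closure Ω, (p, (0 : ℝ)) ∈ U)
    (P Q A B : ℝ × ℝ → ℝ) (M : ℝ) (hM : ∀ p ∈ Ω, |A p| ≤ M)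
    (heq : ∀ p ∈ Ω, (1 + Q p ^ 2) * DD ex (DD ex f) (p, 0) - 2 * P p * Q p * DD ey (DD ex f) (p, 0)
      + (1 + P p ^ 2) * DD ey (DD ey f) (p, 0) + A p * DD ex f (p, 0) + B p * DD ey f (p, 0) = 0)
    (hbd : ∀ p ∈ frontier Ω, f (p, 0) ≤ 0) : ∀ p ∈ closure Ω, f (p, 0) ≤ 0 := by
  by_contra hcon
  push Not at hcon
  obtain ⟨p0, hp0, hpos⟩ := hcon
  have hcomp : IsCompact (closure Ω) := hb.isCompact_closure
  obtain ⟨C, hC⟩ := hcomp.exists_bound_of_continuousOn (f := fun p : ℝ × ℝ => p.1)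
    (by fun_prop)
  set l : ℝ := |M| + 1 with hl
  have hlpos : 0 < l := by positivity
  set η := f (p0, 0) with hη
  set δ : ℝ := η / (2 * Real.exp (l * C)) with hδ
  have hδpos : 0 < δ := by positivity
  set k : E3 → ℝ := fun q => Real.exp (l * q.1.1) with hk
  have hkan : AnalyticOnNhd ℝ k U := by
    intro q _
    have : AnalyticAt ℝ (fun q : E3 => q.1.1) q :=
      ((ContinuousLinearMap.fst ℝ ℝ ℝ).comp (ContinuousLinearMap.fst ℝ (ℝ × ℝ) ℝ)).analyticAt q
    exact (analyticAt_const.mul this).rexp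
  have hkD : ∀ e : E3, DD e k = fun q => (l * e.1.1) * k q := by
    intro e
    funext q
    have h1 : HasFDerivAt (fun q : E3 => q.1.1)
      ((ContinuousLinearMap.fst ℝ ℝ ℝ).comp (ContinuousLinearMap.fst ℝ (ℝ × ℝ) ℝ)) q :=
      ((ContinuousLinearMap.fst ℝ ℝ ℝ).comp (ContinuousLinearMap.fst ℝ (ℝ × ℝ) ℝ)).hasFDerivAt
    have h2 : HasFDerivAt k _ q := (h1.const_mul l).exp
    simp only [DD, h2.fderiv]
    simp [hk]
    ring
  set g : E3 → ℝ := fun q => 1 * f q + δ * k q with hg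
  have hgan : AnalyticOnNhd ℝ g U := fun q hq =>
    (analyticAt_const.mul (hf q hq)).add (analyticAt_const.mul (hkan q hq))
  have hgcont : ContinuousOn (fun p : ℝ × ℝ => g (p, 0)) (closure Ω) := by
    intro p hp
    have h1 : ContinuousAt g (p, 0) := (hgan _ (hsub p hp)).continuousAt
    have h2 : ContinuousAt (fun p : ℝ × ℝ => ((p, 0) : E3)) p := by fun_prop
    exact (ContinuousAt.comp (f := fun p : ℝ × ℝ => ((p, 0) : E3)) h1 h2).continuousWithinAt
  obtain ⟨p1, hp1, hmax⟩ := hcomp.exists_isMaxOn ⟨p0, hp0⟩ hgcont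
  have hge : η < g (p1, 0) := by
    have h1 : g (p0, 0) ≤ g (p1, 0) := hmax hp0
    have h2 : 0 < δ * k (p0, 0) := mul_pos hδpos (Real.exp_pos _)
    simp only [hg] at h1 ⊢
    linarith
  have hp1Ω : p1 ∈ Ω := by
    by_contra hnot
    have hfr : p1 ∈ frontier Ω := by
      rw [frontier, hΩ.interior_eq]; exact ⟨hp1, hnot⟩
    have h1 := hbd p1 hfr
    have h2 : k (p1, 0) ≤ Real.exp (l * C) := by
      apply Real.exp_le_exp.2
      have := hC p1 hp1
      have h3 : p1.1 ≤ C := (le_abs_self _).trans this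
      exact mul_le_mul_of_nonneg_left h3 hlpos.le
    have h4 : δ * k (p1, 0) ≤ δ * Real.exp (l * C) := mul_le_mul_of_nonneg_left h2 hδpos.le
    have h5 : δ * Real.exp (l * C) = η / 2 := by rw [hδ]; field_simp
    have : g (p1, 0) ≤ η / 2 := by simp only [hg]; linarith
    linarith
  have hq := hsub p1 hp1
  have hm : ∀ p' ∈ Ω, g (p', 0) ≤ g (p1, 0) := fun p' hp' => hmax (subset_closure hp')
  have L := fun v => line_max hU hgan hΩ hp1Ω hq hm v
  have gD : ∀ e, EqOn (DD e g) (fun q => 1 * DD e f q + (δ * (l * e.1.1)) * k q) U := by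
    intro e q hq
    rw [hg, DD_add_mul (hf q hq) (hkan q hq), hkD]
    ring
  have gDD : ∀ e e', DD e' (DD e g) (p1, 0)
      = DD e' (DD e f) (p1, 0) + δ * (l * e.1.1) * (l * e'.1.1) * k (p1, 0) := by
    intro e e'
    rw [DD_congr hU (gD e) e' hq, DD_add_mul (DD_analytic hf e _ hq) (hkan _ hq), hkD]
    ring
  have e1 : DD ex f (p1, 0) = - (δ * l * k (p1, 0)) := by
    have := (L (1, 0)).1
    have h := gD ex hq
    change DD ex g (p1, 0) = 0 at this
    rw [this] at h
    simp [ex] at h ⊢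
    linarith
  have e2 : DD ey f (p1, 0) = 0 := by
    have := (L (0, 1)).1
    have h := gD ey hq
    change DD ey g (p1, 0) = 0 at this
    rw [this] at h
    simp [ey] at h ⊢
    linarith
  have s1 : DD ex (DD ex f) (p1, 0) + δ * l * l * k (p1, 0) ≤ 0 := by
    have h := (L (1, 0)).2
    change DD ex (DD ex g) (p1, 0) ≤ 0 at h
    rw [gDD] at h
    simpa [ex] using h
  have s2 : DD ey (DD ey f) (p1, 0) ≤ 0 := by
    have h := (L (0, 1)).2
    change DD ey (DD ey g) (p1, 0) ≤ 0 at h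
    rw [gDD] at h
    simpa [ey] using h
  have s3 : ∀ a b : ℝ, a ^ 2 * (DD ex (DD ex f) (p1, 0) + δ * l * l * k (p1, 0))
      + 2 * a * b * DD ey (DD ex f) (p1, 0) + b ^ 2 * DD ey (DD ey f) (p1, 0) ≤ 0 := by
    intro a b
    have h := (L (a, b)).2
    rw [show (((a, b), 0) : E3) = a • ex + b • ey by simp [ex, ey]] at h
    rw [gDD, DD_lin a b ex ey f,
      DD_add_mul (DD_analytic hf ex _ hq) (DD_analytic hf ey _ hq),
      DD_lin a b ex ey, DD_lin a b ex ey] at h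
    have hc := DD_comm hf ex ey hq
    simp only [hc] at h
    have : (a • ex + b • ey : E3).1.1 = a := by simp [ex, ey]
    rw [this] at h
    linarith
  have hE := heq p1 hp1Ω
  have s4 := s3 (Q p1) (- P p1)
  rw [e1, e2] at hE
  have hA := hM p1 hp1Ω
  have hA2 : -|M| ≤ A p1 ∧ A p1 ≤ |M| := abs_le.1 (hA.trans (le_abs_self M))
  have hkp : 0 < δ * l * k (p1, 0) := by have := Real.exp_pos (l * p1.1); positivity
  have : (δ * l * k (p1, 0)) * (l - |M|) ≤ 0 := by
    have i1 : 0 ≤ (δ * l * k (p1, 0)) * (A p1 - -|M|) := mul_nonneg hkp.le (sub_nonneg.2 hA2.1)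
    have i2 : 0 ≤ Q p1 ^ 2 * (δ * l * k (p1, 0)) * l :=
      mul_nonneg (mul_nonneg (sq_nonneg _) hkp.le) hlpos.le
    linarith
  have h6 : l - |M| = 1 := by rw [hl]; ring
  rw [h6] at this
  linarith

/-- Leading order behaviour of a function vanishing to order `m`. -/
lemma lead_coeff {φ : ℝ → ℝ} (hφ : AnalyticAt ℝ φ 0) (m : ℕ)
    (h : ∀ j < m, iteratedDeriv j φ 0 = 0) :
    Tendsto (fun t => φ t / t ^ m) (𝓝[>] 0) (𝓝 (iteratedDeriv m φ 0 / m.factorial)) := by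
  obtain ⟨R, hR, he⟩ := hφ.exists_eventuallyEq_sum_add_pow_mul (m + 1)
  have h1 : Tendsto (fun t : ℝ => iteratedDeriv m φ 0 / m.factorial + t * R t) (𝓝[>] 0)
      (𝓝 (iteratedDeriv m φ 0 / m.factorial)) := by
    have : ContinuousAt (fun t : ℝ => iteratedDeriv m φ 0 / m.factorial + t * R t) 0 :=
      continuousAt_const.add (continuousAt_id.mul hR.continuousAt)
    have h2 := this.tendsto
    simp only [zero_mul, add_zero] at h2
    exact h2.mono_left nhdsWithin_le_nhds
  refine h1.congr' ?_
  filter_upwards [nhdsWithin_le_nhds he, self_mem_nhdsWithin] with t ht htp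
  have htp' : (0 : ℝ) < t := htp
  rw [ht, Finset.sum_range_succ, Finset.sum_eq_zero]
  · simp only [smul_eq_mul]
    field_simp
    ring
  · intro i hi
    rw [h i (Finset.mem_range.1 hi)]; simp

/-- Linearisation of the equation at leading order (one-variable form). -/
lemma linearise (m : ℕ) {P Q R S T P' Q' R' S' T' : ℝ → ℝ} {p q r s u a b c d e : ℝ}
    (hP : Tendsto P (𝓝[>] 0) (𝓝 p)) (hQ : Tendsto Q (𝓝[>] 0) (𝓝 q))
    (hR : Tendsto R (𝓝[>] 0) (𝓝 r)) (hS : Tendsto S (𝓝[>] 0) (𝓝 s))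
    (hT : Tendsto T (𝓝[>] 0) (𝓝 u))
    (hP' : Tendsto P' (𝓝[>] 0) (𝓝 p)) (hQ' : Tendsto Q' (𝓝[>] 0) (𝓝 q))
    (hR' : Tendsto R' (𝓝[>] 0) (𝓝 r)) (hS' : Tendsto S' (𝓝[>] 0) (𝓝 s))
    (hT' : Tendsto T' (𝓝[>] 0) (𝓝 u))
    (ha : Tendsto (fun t => (P t - P' t) / t ^ m) (𝓝[>] 0) (𝓝 a))
    (hb : Tendsto (fun t => (Q t - Q' t) / t ^ m) (𝓝[>] 0) (𝓝 b))
    (hc : Tendsto (fun t => (R t - R' t) / t ^ m) (𝓝[>] 0) (𝓝 c))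
    (hd : Tendsto (fun t => (S t - S' t) / t ^ m) (𝓝[>] 0) (𝓝 d))
    (he : Tendsto (fun t => (T t - T' t) / t ^ m) (𝓝[>] 0) (𝓝 e))
    (hpos : 0 < s ^ 2 - r * u)
    (h1 : ∀ᶠ t in 𝓝[>] (0 : ℝ), (1 + Q t ^ 2) * R t - 2 * P t * Q t * S t + (1 + P t ^ 2) * T t
      = t * Real.sqrt ((1 + P t ^ 2 + Q t ^ 2) * (S t ^ 2 - R t * T t)))
    (h2 : ∀ᶠ t in 𝓝[>] (0 : ℝ), (1 + Q' t ^ 2) * R' t - 2 * P' t * Q' t * S' t + (1 + P' t ^ 2) * T' t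
      = t * Real.sqrt ((1 + P' t ^ 2 + Q' t ^ 2) * (S' t ^ 2 - R' t * T' t))) :
    (1 + q ^ 2) * c - 2 * p * q * d + (1 + p ^ 2) * e + (2 * p * u - 2 * q * s) * a
      + (2 * q * r - 2 * p * s) * b = 0 := by
  have ht : Tendsto (fun t : ℝ => t) (𝓝[>] 0) (𝓝 0) := tendsto_id.mono_left nhdsWithin_le_nhds
  -- left-hand side
  have hL : Tendsto (fun t => (1 + Q t ^ 2) * ((R t - R' t) / t ^ m)
      + R' t * (Q t + Q' t) * ((Q t - Q' t) / t ^ m)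
      - 2 * (P t * Q t * ((S t - S' t) / t ^ m) + S' t * P t * ((Q t - Q' t) / t ^ m)
        + S' t * Q' t * ((P t - P' t) / t ^ m))
      + (1 + P t ^ 2) * ((T t - T' t) / t ^ m)
      + T' t * (P t + P' t) * ((P t - P' t) / t ^ m)) (𝓝[>] 0)
      (𝓝 ((1 + q ^ 2) * c + r * (q + q) * b - 2 * (p * q * d + s * p * b + s * q * a)
        + (1 + p ^ 2) * e + u * (p + p) * a)) :=
    ((((((hQ.pow 2).const_add 1).mul hc).add ((hR'.mul (hQ.add hQ')).mul hb)).sub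
      (((((hP.mul hQ).mul hd).add ((hS'.mul hP).mul hb)).add ((hS'.mul hQ').mul ha)).const_mul 2)).add
      (((hP.pow 2).const_add 1).mul he)).add ((hT'.mul (hP.add hP')).mul ha)
  -- right-hand side
  set A : ℝ → ℝ := fun t => (1 + P t ^ 2 + Q t ^ 2) * (S t ^ 2 - R t * T t) with hA
  set A' : ℝ → ℝ := fun t => (1 + P' t ^ 2 + Q' t ^ 2) * (S' t ^ 2 - R' t * T' t) with hA'
  set k := (1 + p ^ 2 + q ^ 2) * (s ^ 2 - r * u) with hk
  have hkpos : 0 < k := by positivity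
  have hAt : Tendsto A (𝓝[>] 0) (𝓝 k) :=
    (((hP.pow 2).const_add 1).add (hQ.pow 2)).mul ((hS.pow 2).sub (hR.mul hT))
  have hAt' : Tendsto A' (𝓝[>] 0) (𝓝 k) :=
    (((hP'.pow 2).const_add 1).add (hQ'.pow 2)).mul ((hS'.pow 2).sub (hR'.mul hT'))
  have hD := ((((hP.add hP').mul ha).add ((hQ.add hQ').mul hb)).mul
    ((hS.pow 2).sub (hR.mul hT))).add
    ((((hP'.pow 2).const_add 1).add (hQ'.pow 2)).mul
      ((((hS.add hS').mul hd).sub (hR.mul he)).sub (hT'.mul hc)))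
  have hsq := (hAt.sqrt.add hAt'.sqrt)
  have hsqpos : Real.sqrt k + Real.sqrt k ≠ 0 := by
    have := Real.sqrt_pos.2 hkpos; positivity
  have hRHS := ht.mul (hD.div hsq hsqpos)
  rw [zero_mul] at hRHS
  have hEq := tendsto_nhds_unique (hL.congr' (f₂ := _) ?_) hRHS
  · linarith
  · filter_upwards [h1, h2, self_mem_nhdsWithin, hAt.eventually (lt_mem_nhds hkpos),
      hAt'.eventually (lt_mem_nhds hkpos)] with t e1 e2 htp p1 p2
    have htp' : (0 : ℝ) < t := htp
    have hs1 := Real.sqrt_pos.2 p1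
    have hs2 := Real.sqrt_pos.2 p2
    have hm : t ^ m ≠ 0 := by positivity
    have hdiff : Real.sqrt (A t) - Real.sqrt (A' t)
        = (A t - A' t) / (Real.sqrt (A t) + Real.sqrt (A' t)) := by
      rw [eq_div_iff (by positivity)]
      have q1 := Real.mul_self_sqrt p1.le
      have q2 := Real.mul_self_sqrt p2.le
      linarith
    have hAA : (A t - A' t) / t ^ m = ((P t + P' t) * ((P t - P' t) / t ^ m)
        + (Q t + Q' t) * ((Q t - Q' t) / t ^ m)) * (S t ^ 2 - R t * T t)
        + (1 + P' t ^ 2 + Q' t ^ 2) * ((S t + S' t) * ((S t - S' t) / t ^ m)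
          - R t * ((T t - T' t) / t ^ m) - T' t * ((R t - R' t) / t ^ m)) := by
      simp only [hA, hA']
      field_simp
      ring
    simp only [Pi.div_apply]
    rw [← hAA]
    have : (A t - A' t) / t ^ m / (Real.sqrt (A t) + Real.sqrt (A' t))
        = (Real.sqrt (A t) - Real.sqrt (A' t)) / t ^ m := by
      rw [hdiff, div_right_comm]
    rw [this, show t * ((Real.sqrt (A t) - Real.sqrt (A' t)) / t ^ m)
      = (t * Real.sqrt (A t) - t * Real.sqrt (A' t)) / t ^ m by ring]
    change _ = t * Real.sqrt (A t) at e1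
    change _ = t * Real.sqrt (A' t) at e2
    rw [← e1, ← e2]
    field_simp
    ring

lemma disc_pos {p q r s u : ℝ} (h : (1 + q ^ 2) * r - 2 * p * q * s + (1 + p ^ 2) * u = 0)
    (hne : r * u - s ^ 2 ≠ 0) : 0 < s ^ 2 - r * u := by
  rcases lt_or_gt_of_ne hne with h1 | h1
  · linarith
  · exfalso
    have h2 : (1 + q ^ 2) * r ^ 2 - 2 * p * q * s * r + (1 + p ^ 2) * (r * u) = 0 := by
      linear_combination r * h
    nlinarith [sq_nonneg (q * r - p * s), sq_nonneg r, sq_nonneg s, mul_nonneg (sq_nonneg p) h1.le]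

lemma slice_all {g : ℝ × ℝ → ℝ} {f : E3 → ℝ} {U : Set E3} {Ω : Set (ℝ × ℝ)} {t : ℝ}
    (hΩ : IsOpen Ω) (hf : AnalyticOnNhd ℝ f U) (hU : ∀ p ∈ Ω, (p, t) ∈ U)
    (h : ∀ p ∈ Ω, g p = f (p, t)) : ∀ p ∈ Ω, pdx g p = DD ex f (p, t) ∧ pdy g p = DD ey f (p, t) ∧
      fxx g p = DD ex (DD ex f) (p, t) ∧ fxy g p = DD ey (DD ex f) (p, t) ∧
      fyy g p = DD ey (DD ey f) (p, t) := by
  have h1 := pdx_slice hΩ hf hU h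
  have h2 := pdy_slice hΩ hf hU h
  intro p hp
  exact ⟨h1 p hp, h2 p hp, pdx_slice hΩ (DD_analytic hf ex) hU h1 p hp,
    pdy_slice hΩ (DD_analytic hf ex) hU h1 p hp, pdy_slice hΩ (DD_analytic hf ey) hU h2 p hp⟩

/-- Uniqueness of a real analytic family of solutions of the Euclidean
CRPC equations containing a given minimal graph and having fixed boundary values. -/
theorem stmt_13 (Ω : Set (ℝ × ℝ)) (hΩ : IsAnalyticJordanDomain Ω)
    (f0 : ℝ × ℝ → ℝ) (hf0 : AnalyticOnClosed f0 (closure Ω))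
    (hmin : ∀ p ∈ closure Ω,
      (1 + (pdy f0 p) ^ 2) * fxx f0 p - 2 * pdx f0 p * pdy f0 p * fxy f0 p
        + (1 + (pdx f0 p) ^ 2) * fyy f0 p = 0)
    (hflat : ∀ p ∈ closure Ω, fxx f0 p * fyy f0 p - (fxy f0 p) ^ 2 ≠ 0)
    (ε : ℝ) (hε : 0 < ε) :
    ∀ F G : (ℝ × ℝ) × ℝ → ℝ,
      IsEuclideanCRPCFamily Ω f0 ε F → IsEuclideanCRPCFamily Ω f0 ε G →
      ∀ p ∈ closure Ω, ∀ t ∈ Icc (-ε) ε, F (p, t) = G (p, t) := by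
  rintro F G ⟨⟨U, F', hUo, hUs, hFa, hFe⟩, hF0, hFb, hFq⟩ ⟨⟨V, G', hVo, hVs, hGa, hGe⟩, hG0, hGb, hGq⟩
  obtain ⟨hΩo, hΩb, -, -⟩ := hΩ
  set W := U ∩ V with hW
  have hWo : IsOpen W := hUo.inter hVo
  have hFW : AnalyticOnNhd ℝ F' W := hFa.mono inter_subset_left
  have hGW : AnalyticOnNhd ℝ G' W := hGa.mono inter_subset_right
  have h0 : (0 : ℝ) ∈ Icc (-ε) ε := ⟨by linarith, hε.le⟩
  have hmem : ∀ p ∈ closure Ω, ∀ t ∈ Icc (-ε) ε, ((p, t) : E3) ∈ W :=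
    fun p hp t ht => ⟨hUs ⟨hp, ht⟩, hVs ⟨hp, ht⟩⟩
  have hIcc : Icc (-ε) ε ∈ 𝓝 (0 : ℝ) := Icc_mem_nhds (by linarith) hε
  set H : E3 → ℝ := fun q => F' q - G' q with hH
  have hHW : AnalyticOnNhd ℝ H W := fun q hq => (hFW q hq).sub (hGW q hq)
  have hFs : ∀ t ∈ Icc (-ε) ε, ∀ p ∈ Ω, F (p, t) = F' (p, t) :=
    fun t ht p hp => hFe ⟨subset_closure hp, ht⟩
  have hGs : ∀ t ∈ Icc (-ε) ε, ∀ p ∈ Ω, G (p, t) = G' (p, t) :=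
    fun t ht p hp => hGe ⟨subset_closure hp, ht⟩
  have hmemΩ : ∀ t ∈ Icc (-ε) ε, ∀ p ∈ Ω, ((p, t) : E3) ∈ W :=
    fun t ht p hp => hmem p (subset_closure hp) t ht
  have SF0 := slice_all hΩo hFW (hmemΩ 0 h0)
    (fun p hp => (hF0 p (subset_closure hp)).symm.trans (hFs 0 h0 p hp))
  have SG0 := slice_all hΩo hGW (hmemΩ 0 h0)
    (fun p hp => (hG0 p (subset_closure hp)).symm.trans (hGs 0 h0 p hp))
  have eqF : ∀ p ∈ Ω, ∀ᶠ t in 𝓝[>] (0 : ℝ), EuclideanCRPCAt t (fun q => F (q, t)) p ∧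
      t ∈ Icc (-ε) ε := fun p hp => by
    filter_upwards [nhdsWithin_le_nhds hIcc] with t ht using ⟨hFq t ht p hp, ht⟩
  have cts : ∀ (K : E3 → ℝ), AnalyticOnNhd ℝ K W → ∀ p ∈ Ω,
      Tendsto (fun t : ℝ => K (p, t)) (𝓝[>] 0) (𝓝 (K (p, 0))) := by
    intro K hK p hp
    have h1 : ContinuousAt K (p, 0) := (hK _ (hmemΩ 0 h0 p hp)).continuousAt
    have h2 : ContinuousAt (fun t : ℝ => ((p, t) : E3)) 0 := by fun_prop
    exact (ContinuousAt.comp (f := fun t : ℝ => ((p, t) : E3)) h1 h2).tendsto.mono_left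
      nhdsWithin_le_nhds
  have Fx := DD_analytic hFW ex
  have Fy := DD_analytic hFW ey
  have Fxx := DD_analytic Fx ex
  have Fxy := DD_analytic Fx ey
  have Fyy := DD_analytic Fy ey
  have Gx := DD_analytic hGW ex
  have Gy := DD_analytic hGW ey
  have Gxx := DD_analytic Gx ex
  have Gxy := DD_analytic Gx ey
  have Gyy := DD_analytic Gy ey
  set A : ℝ × ℝ → ℝ := fun p => 2 * DD ex F' (p, 0) * DD ey (DD ey F') (p, 0)
    - 2 * DD ey F' (p, 0) * DD ey (DD ex F') (p, 0) with hA
  set B : ℝ × ℝ → ℝ := fun p => 2 * DD ey F' (p, 0) * DD ex (DD ex F') (p, 0)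
    - 2 * DD ex F' (p, 0) * DD ey (DD ex F') (p, 0) with hB
  have ctsA : ∀ (K : E3 → ℝ), AnalyticOnNhd ℝ K W →
      ContinuousOn (fun p : ℝ × ℝ => K (p, 0)) (closure Ω) := by
    intro K hK p hp
    have h1 : ContinuousAt K (p, 0) := (hK _ (hmem p hp 0 h0)).continuousAt
    have h2 : ContinuousAt (fun p : ℝ × ℝ => ((p, 0) : E3)) p := by fun_prop
    exact (ContinuousAt.comp (f := fun p : ℝ × ℝ => ((p, 0) : E3)) h1 h2).continuousWithinAt
  obtain ⟨M, hM⟩ := hΩb.isCompact_closure.exists_bound_of_continuousOn (f := A)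
    (((continuousOn_const.mul (ctsA _ Fx)).mul (ctsA _ Fyy)).sub
      ((continuousOn_const.mul (ctsA _ Fy)).mul (ctsA _ Fxy)))
  have Hfr : ∀ p ∈ frontier Ω, ∀ t ∈ Icc (-ε) ε, H (p, t) = 0 := by
    intro p hp t ht
    have hpc := frontier_subset_closure hp
    simp only [hH]
    rw [← hFe ⟨hpc, ht⟩, ← hGe ⟨hpc, ht⟩, hFb p hp t ht, hGb p hp t ht, sub_self]
  have Z : ∀ m : ℕ, ∀ p ∈ closure Ω, (DD et)^[m] H (p, 0) = 0 := by
    intro m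
    induction m using Nat.strong_induction_on with
    | _ m ih =>
    set f := (DD et)^[m] H with hf
    have hfW : AnalyticOnNhd ℝ f W := DDt_analytic hHW et m
    have hfr : ∀ p ∈ frontier Ω, f (p, 0) = 0 := by
      intro p hp
      rw [hf, ← iter_t hWo hHW p m 0 (hmem p (frontier_subset_closure hp) 0 h0)]
      have : (fun t => H (p, t)) =ᶠ[𝓝 0] fun _ => (0 : ℝ) := by
        filter_upwards [hIcc] with t ht using Hfr p hp t ht
      rw [this.iteratedDeriv_eq]
      simp
    have heq : ∀ p ∈ Ω, (1 + DD ey F' (p, 0) ^ 2) * DD ex (DD ex f) (p, 0)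
        - 2 * DD ex F' (p, 0) * DD ey F' (p, 0) * DD ey (DD ex f) (p, 0)
        + (1 + DD ex F' (p, 0) ^ 2) * DD ey (DD ey f) (p, 0)
        + A p * DD ex f (p, 0) + B p * DD ey f (p, 0) = 0 := by
      intro p hp
      have hpW := hmemΩ 0 h0 p hp
      -- commutation
      have c1 : ∀ (e : E3) (j : ℕ), EqOn ((DD et)^[j] (DD e H)) (DD e ((DD et)^[j] H)) W :=
        fun e j => DDt_comm hWo hHW et e j
      have c2 : ∀ (e e' : E3) (j : ℕ),
          EqOn ((DD et)^[j] (DD e' (DD e H))) (DD e' (DD e ((DD et)^[j] H))) W :=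
        fun e e' j => (DDt_comm hWo (DD_analytic hHW e) et e' j).trans (DD_congr hWo (c1 e j) e')
      have zx : ∀ K : E3 → ℝ, AnalyticOnNhd ℝ K W → (∀ p ∈ Ω, K (p, 0) = 0) →
          ∀ p ∈ Ω, DD ex K (p, 0) = 0 := by
        intro K hK hz p hp
        rw [← pdx_slice (g := fun _ => 0) hΩo hK (hmemΩ 0 h0) (fun p hp => (hz p hp).symm) p hp]
        simp [pdx]
      have zy : ∀ K : E3 → ℝ, AnalyticOnNhd ℝ K W → (∀ p ∈ Ω, K (p, 0) = 0) →
          ∀ p ∈ Ω, DD ey K (p, 0) = 0 := by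
        intro K hK hz p hp
        rw [← pdy_slice (g := fun _ => 0) hΩo hK (hmemΩ 0 h0) (fun p hp => (hz p hp).symm) p hp]
        simp [pdy]
      have d1 : ∀ e, EqOn (DD e H) (fun q => DD e F' q - DD e G' q) W := fun e => DD_sub hFW hGW e
      have d2 : ∀ e e', EqOn (DD e' (DD e H))
          (fun q => DD e' (DD e F') q - DD e' (DD e G') q) W := fun e e' =>
        (DD_congr hWo (d1 e) e').trans (DD_sub (DD_analytic hFW e) (DD_analytic hGW e) e')
      have lead : ∀ K K1 K2 : E3 → ℝ, AnalyticOnNhd ℝ K W → EqOn K (fun q => K1 q - K2 q) W →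
          (∀ j < m, (DD et)^[j] K (p, 0) = 0) →
          Tendsto (fun t : ℝ => (K1 (p, t) - K2 (p, t)) / t ^ m) (𝓝[>] 0)
            (𝓝 ((DD et)^[m] K (p, 0) / m.factorial)) := by
        intro K K1 K2 hK hKK hz
        have han : AnalyticAt ℝ (fun t : ℝ => K (p, t)) 0 :=
          AnalyticAt.fun_comp (g := K) (f := fun t : ℝ => ((p, t) : E3)) (hK _ hpW)
            (analyticAt_const.prod analyticAt_id)
        have := lead_coeff han m (fun j hj => by rw [iter_t hWo hK p j 0 hpW]; exact hz j hj)
        rw [iter_t hWo hK p m 0 hpW] at this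
        refine this.congr' ?_
        filter_upwards [nhdsWithin_le_nhds hIcc] with t ht
        rw [hKK (hmemΩ t ht p hp)]
      have ihΩ : ∀ j < m, ∀ p ∈ Ω, (DD et)^[j] H (p, 0) = 0 :=
        fun j hj p hp => ih j hj p (subset_closure hp)
      have an := fun j => DDt_analytic hHW et j
      have lx := lead _ _ _ (DD_analytic hHW ex) (d1 ex) (fun j hj => by
        rw [c1 ex j hpW]; exact zx _ (an j) (ihΩ j hj) p hp)
      have ly := lead _ _ _ (DD_analytic hHW ey) (d1 ey) (fun j hj => by
        rw [c1 ey j hpW]; exact zy _ (an j) (ihΩ j hj) p hp)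
      have lxx := lead _ _ _ (DD_analytic (DD_analytic hHW ex) ex) (d2 ex ex) (fun j hj => by
        rw [c2 ex ex j hpW]
        exact zx _ (DD_analytic (an j) ex) (zx _ (an j) (ihΩ j hj)) p hp)
      have lxy := lead _ _ _ (DD_analytic (DD_analytic hHW ex) ey) (d2 ex ey) (fun j hj => by
        rw [c2 ex ey j hpW]
        exact zy _ (DD_analytic (an j) ex) (zx _ (an j) (ihΩ j hj)) p hp)
      have lyy := lead _ _ _ (DD_analytic (DD_analytic hHW ey) ey) (d2 ey ey) (fun j hj => by
        rw [c2 ey ey j hpW]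
        exact zy _ (DD_analytic (an j) ey) (zy _ (an j) (ihΩ j hj)) p hp)
      rw [c1 ex m hpW] at lx
      rw [c1 ey m hpW] at ly
      rw [c2 ex ex m hpW] at lxx
      rw [c2 ex ey m hpW] at lxy
      rw [c2 ey ey m hpW] at lyy
      obtain ⟨f1, f2, f3, f4, f5⟩ := SF0 p hp
      obtain ⟨g1, g2, g3, g4, g5⟩ := SG0 p hp
      have hpos : 0 < DD ey (DD ex F') (p, 0) ^ 2
          - DD ex (DD ex F') (p, 0) * DD ey (DD ey F') (p, 0) := by
        have h1 := hmin p (subset_closure hp)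
        have h2 := hflat p (subset_closure hp)
        rw [f1, f2, f3, f4, f5] at h1
        rw [f3, f4, f5] at h2
        exact disc_pos h1 h2
      have tG1 := cts _ Gx p hp
      have tG2 := cts _ Gy p hp
      have tG3 := cts _ Gxx p hp
      have tG4 := cts _ Gxy p hp
      have tG5 := cts _ Gyy p hp
      rw [← g1, f1] at tG1
      rw [← g2, f2] at tG2
      rw [← g3, f3] at tG3
      rw [← g4, f4] at tG4
      rw [← g5, f5] at tG5
      have main := linearise m (cts _ Fx p hp) (cts _ Fy p hp) (cts _ Fxx p hp) (cts _ Fxy p hp)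
        (cts _ Fyy p hp) tG1 tG2 tG3 tG4 tG5 lx ly lxx lxy lyy hpos
        (by
          filter_upwards [nhdsWithin_le_nhds hIcc] with t ht
          obtain ⟨a1, a2, a3, a4, a5⟩ := slice_all (g := fun q => F (q, t)) hΩo hFW (hmemΩ t ht)
            (fun p hp => hFs t ht p hp) p hp
          have := hFq t ht p hp
          unfold EuclideanCRPCAt at this
          rw [a1, a2, a3, a4, a5] at this
          exact this)
        (by
          filter_upwards [nhdsWithin_le_nhds hIcc] with t ht
          obtain ⟨a1, a2, a3, a4, a5⟩ := slice_all (g := fun q => G (q, t)) hΩo hGW (hmemΩ t ht)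
            (fun p hp => hGs t ht p hp) p hp
          have := hGq t ht p hp
          unfold EuclideanCRPCAt at this
          rw [a1, a2, a3, a4, a5] at this
          exact this)
      have hfac : (m.factorial : ℝ) ≠ 0 := by positivity
      rw [← hf] at main
      simp only [hA, hB]
      field_simp at main
      linarith
    intro p hp
    apply le_antisymm
    · exact max_principle hWo hfW hΩo hΩb (fun p hp => hmem p hp 0 h0) _ _ A B M
        (fun p hp => hM p (subset_closure hp)) heq (fun p hp => (hfr p hp).le) p hp
    · have := max_principle (f := fun q => - f q) hWo (fun q hq => (hfW q hq).neg) hΩo hΩb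
        (fun p hp => hmem p hp 0 h0) (fun p => DD ex F' (p, 0)) (fun p => DD ey F' (p, 0)) A B M
        (fun p hp => hM p (subset_closure hp))
        (fun p hp => by
          have := heq p hp
          simp only [DD_neg]
          linarith) (fun p hp => by simp [hfr p hp]) p hp
      linarith
  intro p hp t ht
  have han : AnalyticOnNhd ℝ (fun t : ℝ => H (p, t)) (Icc (-ε) ε) := fun s hs =>
    AnalyticAt.fun_comp (g := H) (f := fun t : ℝ => ((p, t) : E3)) (hHW _ (hmem p hp s hs))
      (analyticAt_const.prod analyticAt_id)
  have hev : ∀ᶠ s in 𝓝 (0 : ℝ), H (p, s) = 0 := by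
    rw [← analyticOrderAt_eq_top (f := fun t : ℝ => H (p, t))]
    rw [ENat.eq_top_iff_forall_ge]
    intro n
    rw [natCast_le_analyticOrderAt_iff_iteratedDeriv_eq_zero (han 0 h0)]
    intro i _
    rw [iter_t hWo hHW p i 0 (hmem p hp 0 h0)]
    exact Z i p hp
  have hz := han.eqOn_zero_of_preconnected_of_eventuallyEq_zero isPreconnected_Icc h0 hev ht
  simp only [hH, Pi.zero_apply] at hz
  rw [hFe ⟨hp, ht⟩, hGe ⟨hp, ht⟩]
  linarith

end
end

section
/- Let M, N > 0 and define a sequence of real numbers recursively by a⁽⁰⁾ = M and, for m ≥ 1, a⁽ᵐ⁾ = N·Σ_{p₁+p₂+p₃ = m, 0 ≤ pᵢ < m} (m!/(p₁!p₂!p₃!))·a⁽ᵖ¹⁾a⁽ᵖ²⁾a⁽ᵖ³⁾ + N·m·Σ_{q₁+q₂+q₃+q₄ = m−1, qᵢ ≥ 0} ((m−1)!/(q₁!q₂!q₃!q₄!))·∏_{i=1}^{4} a⁽qᵢ⁾ + (N/(m+1))·Σ_{r₁+⋯+r₆ = m+1, 0 ≤ rᵢ < m} ((m+1)!/(r₁!⋯r₆!))·∏_{i=1}^{6}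 a⁽rᵢ⁾. Then the power series Σ_{m≥0} a⁽ᵐ⁾·tᵐ/m! has positive radius of convergence, and its sum a(t) satisfies, for all t in a neighborhood of 0, the algebraic relation (a(t)⁴·N + 15·M¹²·N³)·t² − t·(a(t) − M)·( 1 − (a(t) − M)·(a(t) + 2M)·N + 30·M⁸·N² ) + a(t)⁶·N − 6·a(t)·M⁵·N + 5·M⁶·N = 0. -/
open Set Filter
open scoped BigOperators Topology

noncomputable section

/-- `Σ_{p₁+p₂+p₃ = m, 0 ≤ pᵢ < m} m!/(p₁!p₂!p₃!) · b p₁ · b p₂ · b p₃`. -/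
def multinom3Sum (b : ℕ → ℝ) (m : ℕ) : ℝ :=
  ∑ p ∈ (Finset.range m ×ˢ Finset.range m ×ˢ Finset.range m).filter
      (fun p => p.1 + p.2.1 + p.2.2 = m),
    ((m.factorial : ℝ) /
        ((p.1.factorial : ℝ) * (p.2.1.factorial : ℝ) * (p.2.2.factorial : ℝ))) *
      (b p.1 * b p.2.1 * b p.2.2)

/-- `Σ_{q₁+q₂+q₃+q₄ = m-1, qᵢ ≥ 0} (m-1)!/(q₁!q₂!q₃!q₄!) · ∏ b qᵢ` (for `m ≥ 1`). -/
def multinom4Sum (b : ℕ → ℝ) (m : ℕ) : ℝ :=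
  ∑ q ∈ (Finset.range m ×ˢ Finset.range m ×ˢ Finset.range m ×ˢ Finset.range m).filter
      (fun q => q.1 + q.2.1 + q.2.2.1 + q.2.2.2 = m - 1),
    (((m - 1).factorial : ℝ) /
        ((q.1.factorial : ℝ) * (q.2.1.factorial : ℝ) * (q.2.2.1.factorial : ℝ) *
          (q.2.2.2.factorial : ℝ))) *
      (b q.1 * b q.2.1 * b q.2.2.1 * b q.2.2.2)

/-- `Σ_{r₁+⋯+r₆ = m+1, 0 ≤ rᵢ < m} (m+1)!/(r₁!⋯r₆!) · ∏ b rᵢ`. -/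
def multinom6Sum (b : ℕ → ℝ) (m : ℕ) : ℝ :=
  ∑ r ∈ (Finset.range m ×ˢ Finset.range m ×ˢ Finset.range m ×ˢ Finset.range m ×ˢ
      Finset.range m ×ˢ Finset.range m).filter
      (fun r => r.1 + r.2.1 + r.2.2.1 + r.2.2.2.1 + r.2.2.2.2.1 + r.2.2.2.2.2 = m + 1),
    (((m + 1).factorial : ℝ) /
        ((r.1.factorial : ℝ) * (r.2.1.factorial : ℝ) * (r.2.2.1.factorial : ℝ) *
          (r.2.2.2.1.factorial : ℝ) * (r.2.2.2.2.1.factorial : ℝ) *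
          (r.2.2.2.2.2.factorial : ℝ))) *
      (b r.1 * b r.2.1 * b r.2.2.1 * b r.2.2.2.1 * b r.2.2.2.2.1 * b r.2.2.2.2.2)

namespace S15
open PowerSeries

/-- truncation -/
def T (b : ℕ → ℝ) (m : ℕ) : PowerSeries ℝ := ∑ i ∈ Finset.range m, PowerSeries.monomial i (b i)

lemma coeff_T (b : ℕ → ℝ) (m n : ℕ) : coeff n (T b m) = if n < m then b n else 0 := by
  simp [T, coeff_monomial]

lemma split (b : ℕ → ℝ) (m : ℕ) :
    PowerSeries.mk b = T b m + X ^ m * PowerSeries.mk (fun i => b (i + m)) := by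
  ext n
  rw [map_add, coeff_T, coeff_X_pow_mul', coeff_mk]
  by_cases h : n < m
  · simp [h, not_le.mpr h]
  · simp [h, not_lt.mp h]

lemma T3 (b : ℕ → ℝ) (m n : ℕ) : coeff n (T b m ^ 3) =
    ∑ p ∈ (Finset.range m ×ˢ Finset.range m ×ˢ Finset.range m).filter
      (fun p => p.1 + p.2.1 + p.2.2 = n), b p.1 * b p.2.1 * b p.2.2 := by
  have : T b m ^ 3 = T b m * (T b m * T b m) := by ring
  rw [this, T, Finset.sum_mul_sum, ← Finset.sum_product', Finset.sum_mul_sum,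
    ← Finset.sum_product', map_sum, Finset.sum_filter]
  refine Finset.sum_congr rfl fun p _ => ?_
  simp only [monomial_mul_monomial, coeff_monomial]
  refine if_congr (by omega) (by ring) rfl

lemma T4 (b : ℕ → ℝ) (m n : ℕ) : coeff n (T b m ^ 4) =
    ∑ q ∈ (Finset.range m ×ˢ Finset.range m ×ˢ Finset.range m ×ˢ Finset.range m).filter
      (fun q => q.1 + q.2.1 + q.2.2.1 + q.2.2.2 = n),
      b q.1 * b q.2.1 * b q.2.2.1 * b q.2.2.2 := by
  have : T b m ^ 4 = T b m * (T b m * (T b m * T b m)) := by ring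
  rw [this, T]
  iterate 3 rw [Finset.sum_mul_sum, ← Finset.sum_product']
  rw [map_sum, Finset.sum_filter]
  refine Finset.sum_congr rfl fun p _ => ?_
  simp only [monomial_mul_monomial, coeff_monomial]
  refine if_congr (by omega) (by ring) rfl

lemma T6 (b : ℕ → ℝ) (m n : ℕ) : coeff n (T b m ^ 6) =
    ∑ r ∈ (Finset.range m ×ˢ Finset.range m ×ˢ Finset.range m ×ˢ Finset.range m ×ˢ
      Finset.range m ×ˢ Finset.range m).filter
      (fun r => r.1 + r.2.1 + r.2.2.1 + r.2.2.2.1 + r.2.2.2.2.1 + r.2.2.2.2.2 = n),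
      b r.1 * b r.2.1 * b r.2.2.1 * b r.2.2.2.1 * b r.2.2.2.2.1 * b r.2.2.2.2.2 := by
  have : T b m ^ 6 = T b m * (T b m * (T b m * (T b m * (T b m * T b m)))) := by ring
  rw [this, T]
  iterate 5 rw [Finset.sum_mul_sum, ← Finset.sum_product']
  rw [map_sum, Finset.sum_filter]
  refine Finset.sum_congr rfl fun p _ => ?_
  simp only [monomial_mul_monomial, coeff_monomial]
  refine if_congr (by omega) (by ring) rfl

lemma m3 (a : ℕ → ℝ) (m : ℕ) : multinom3Sum a m =
    m.factorial * coeff m (T (fun i => a i / i.factorial) m ^ 3) := by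
  rw [T3, multinom3Sum, Finset.mul_sum]
  refine Finset.sum_congr rfl fun p _ => ?_
  field_simp

lemma m4 (a : ℕ → ℝ) (m : ℕ) : multinom4Sum a m =
    (m-1).factorial * coeff (m-1) (T (fun i => a i / i.factorial) m ^ 4) := by
  rw [T4, multinom4Sum, Finset.mul_sum]
  refine Finset.sum_congr rfl fun p _ => ?_
  field_simp

lemma m6 (a : ℕ → ℝ) (m : ℕ) : multinom6Sum a m =
    (m+1).factorial * coeff (m+1) (T (fun i => a i / i.factorial) m ^ 6) := by
  rw [T6, multinom6Sum, Finset.mul_sum]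
  refine Finset.sum_congr rfl fun p _ => ?_
  field_simp

lemma c0T (b : ℕ → ℝ) (k : ℕ) : constantCoeff (T b (k+1)) = b 0 := by
  rw [← coeff_zero_eq_constantCoeff_apply, coeff_T]; simp

lemma A3 (b : ℕ → ℝ) (k : ℕ) : coeff (k+1) (T b (k+1) ^ 3) =
    coeff (k+1) (PowerSeries.mk b ^ 3) - 3 * b 0 ^ 2 * b (k+1) := by
  have h := split b (k+1)
  set R := PowerSeries.mk (fun i => b (i + (k+1))) with hR
  have e : PowerSeries.mk b ^ 3 = T b (k+1) ^ 3 + X ^ (k+1) *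
      (3 * T b (k+1) ^ 2 * R + X * (X ^ k * (3 * T b (k+1) * R ^ 2 + X ^ (k+1) * R ^ 3))) := by
    rw [h]; ring
  have h2 : coeff (k+1) (X ^ (k+1) *
      (3 * T b (k+1) ^ 2 * R + X * (X ^ k * (3 * T b (k+1) * R ^ 2 + X ^ (k+1) * R ^ 3))))
      = 3 * b 0 ^ 2 * b (k+1) := by
    rw [coeff_X_pow_mul']
    have e3 : constantCoeff (3 : PowerSeries ℝ) = 3 := map_ofNat _ 3
    simp [c0T, hR, e3]
  rw [e, map_add, h2]; ring

lemma A4 (b : ℕ → ℝ) (k : ℕ) : coeff k (T b (k+1) ^ 4) = coeff k (PowerSeries.mk b ^ 4) := by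
  have h := split b (k+1)
  set R := PowerSeries.mk (fun i => b (i + (k+1))) with hR
  set Q := T b (k+1)
  have e : PowerSeries.mk b ^ 4 = Q ^ 4 + X ^ (k+1) *
      (4 * Q ^ 3 * R + 6 * Q^2 * R^2 * X ^(k+1) + 4 * Q * R^3 * X^(k+1) * X^(k+1)
        + R^4 * X ^ (k+1) * X ^ (k+1) * X ^ (k+1)) := by
    rw [h]; ring
  rw [e, map_add, coeff_X_pow_mul']; simp

lemma coeff_one_mul' (F G : PowerSeries ℝ) : coeff 1 (F * G) =
    constantCoeff F * coeff 1 G + coeff 1 F * constantCoeff G := by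
  rw [coeff_mul, Finset.Nat.antidiagonal_succ]; simp

lemma A6 (b : ℕ → ℝ) (k : ℕ) : coeff (k+3) (T b (k+2) ^ 6) =
    coeff (k+3) (PowerSeries.mk b ^ 6) - 30 * b 0 ^ 4 * b 1 * b (k+2) - 6 * b 0 ^ 5 * b (k+3) := by
  have h := split b (k+2)
  have h0 := c0T b (k+1)
  have h1 : coeff 1 (T b (k+2)) = b 1 := by rw [coeff_T]; simp
  set R := PowerSeries.mk (fun i => b (i + (k+2))) with hR
  have hR0 : constantCoeff R = b (k+2) := by simp [hR]
  have hR1 : coeff 1 R = b (k+3) := by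
    simp only [hR, coeff_mk]; congr 1; omega
  set Q := T b (k+2)
  have e : PowerSeries.mk b ^ 6 = Q ^ 6 + X ^ (k+2) *
      (6 * (Q * (Q * (Q * (Q * (Q * R))))) + X * (X * (X ^ k * (15 * Q^4*R^2 + 20 * Q^3*R^3*X^(k+2) + 15 * Q^2*R^4*X^(k+2)*X^(k+2)
        + 6 * Q*R^5*X^(k+2)*X^(k+2)*X^(k+2) + R^6 * X^(k+2)*X^(k+2)*X^(k+2)*X^(k+2))))) := by
    rw [h]; ring
  have e6 : (6 : PowerSeries ℝ) = C (6:ℝ) := (map_ofNat C 6).symm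
  rw [e, map_add, coeff_X_pow_mul', if_pos (by omega), show k + 3 - (k+2) = 0 + 1 by omega, map_add,
    coeff_succ_X_mul, e6, coeff_C_mul]
  simp only [zero_add, coeff_one_mul', map_mul, h0, h1, hR0, hR1, coeff_zero_eq_constantCoeff_apply,
    constantCoeff_X]
  ring

lemma A6' (b : ℕ → ℝ) : coeff 2 (PowerSeries.mk b ^ 6) = 6 * b 0 ^ 5 * b 2 + 15 * b 0 ^ 4 * b 1 ^ 2
    ∧ coeff 1 (PowerSeries.mk b ^ 6) = 6 * b 0 ^ 5 * b 1 := by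
  have h : PowerSeries.mk b = C (b 0) + X * PowerSeries.mk (fun i => b (i+1)) := by
    have := split b 1
    rw [this]; simp [T]
  set R := PowerSeries.mk (fun i => b (i + 1)) with hR
  have hR0 : constantCoeff R = b 1 := by simp [hR]
  have hR1 : coeff 1 R = b 2 := by simp [hR]
  have e : PowerSeries.mk b ^ 6 = C (b 0 ^ 6) + X * (C (6 * b 0 ^ 5) * R + X * (C (15 * b 0 ^ 4) * R ^2 +
     X * (20 * C (b 0)^3*R^3 + 15 * X * C (b 0)^2 * R^4 + 6 * X^2 * C (b 0) * R^5 + X^3*R^6))) := by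
    rw [h]; simp only [map_mul, map_pow, map_ofNat]; ring
  rw [e]
  constructor
  · rw [show (2:ℕ) = 0+1+1 by rfl, map_add, coeff_succ_X_mul, map_add, coeff_succ_X_mul, coeff_C_mul]
    have : coeff (0+1+1) (C (b 0 ^ 6)) = 0 := by rw [coeff_C]; simp
    rw [this]
    simp [hR0, hR1]
  · rw [show (1:ℕ) = 0+1 by rfl, map_add, coeff_succ_X_mul]
    have : coeff (0+1) (C (b 0 ^ 6)) = 0 := by rw [coeff_C]; simp
    rw [this]
    simp [hR0]

/-- recursion for the normalised coefficients -/
lemma recb (N : ℝ) (a : ℕ → ℝ) (m : ℕ) (h : a (m+1) =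
      N * multinom3Sum a (m+1) + N * ((m+1 : ℕ) : ℝ) * multinom4Sum a (m+1)
        + N / (((m+1 : ℕ) : ℝ) + 1) * multinom6Sum a (m+1)) :
    a (m+1) / (m+1).factorial =
      N * coeff (m+1) (T (fun i => a i / i.factorial) (m+1) ^ 3)
      + N * coeff m (T (fun i => a i / i.factorial) (m+1) ^ 4)
      + N * coeff (m+2) (T (fun i => a i / i.factorial) (m+1) ^ 6) := by
  rw [h, m3, m4, m6]
  simp only [Nat.add_sub_cancel, Nat.factorial_succ]
  push_cast
  have : (m.factorial : ℝ) ≠ 0 := by positivity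
  field_simp

lemma nonneg_a (M N : ℝ) (hM : 0 < M) (hN : 0 < N) (a : ℕ → ℝ) (ha0 : a 0 = M)
    (ha : ∀ m : ℕ, 1 ≤ m → a m =
      N * multinom3Sum a m + N * (m : ℝ) * multinom4Sum a m
        + N / ((m : ℝ) + 1) * multinom6Sum a m) (m : ℕ) : 0 ≤ a m := by
  induction m using Nat.strong_induction_on with
  | _ m ih =>
    rcases Nat.eq_zero_or_pos m with rfl | hm
    · rw [ha0]; exact hM.le
    · rw [ha m hm]
      have h3 : 0 ≤ multinom3Sum a m := by
        refine Finset.sum_nonneg fun p hp => ?_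
        simp only [Finset.mem_filter, Finset.mem_product, Finset.mem_range] at hp
        have := ih _ hp.1.1
        have := ih _ hp.1.2.1
        have := ih _ hp.1.2.2
        positivity
      have h4 : 0 ≤ multinom4Sum a m := by
        refine Finset.sum_nonneg fun p hp => ?_
        simp only [Finset.mem_filter, Finset.mem_product, Finset.mem_range] at hp
        have := ih _ hp.1.1
        have := ih _ hp.1.2.1
        have := ih _ hp.1.2.2.1
        have := ih _ hp.1.2.2.2
        positivity
      have h6 : 0 ≤ multinom6Sum a m := by
        refine Finset.sum_nonneg fun p hp => ?_
        simp only [Finset.mem_filter, Finset.mem_product, Finset.mem_range] at hp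
        have := ih _ hp.1.1
        have := ih _ hp.1.2.1
        have := ih _ hp.1.2.2.1
        have := ih _ hp.1.2.2.2.1
        have := ih _ hp.1.2.2.2.2.1
        have := ih _ hp.1.2.2.2.2.2
        positivity
      positivity

/-- formal relation -/
lemma formal (M N : ℝ) (b : ℕ → ℝ) (h0 : b 0 = M)
    (hb : ∀ m, b (m+1) = N * coeff (m+1) (T b (m+1) ^ 3) + N * coeff m (T b (m+1) ^ 4)
      + N * coeff (m+2) (T b (m+1) ^ 6)) :
    b 1 = N * M ^ 4 ∧
    X * PowerSeries.mk b = C M * X + C N * (X * (PowerSeries.mk b ^ 3))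
      + C (2 * N * M^3) * X - C (3 * N * M^2) * (X * PowerSeries.mk b)
      + C N * (X * (X * PowerSeries.mk b ^ 4))
      + C N * PowerSeries.mk b ^ 6 - C (6 * N * M^5) * PowerSeries.mk b + C (5 * N * M^6)
      - C (30 * N^2 * M^8) * (X * PowerSeries.mk b) + C (30 * N^2 * M^9) * X
      + C (15 * N^3 * M^12) * (X * X) := by
  have hT : T b 1 = C M := by simp [T, h0]
  have h1 : b 1 = N * M ^ 4 := by
    have := hb 0
    rw [zero_add, hT] at this
    simp only [← map_pow, coeff_C] at this
    simpa using this
  refine ⟨h1, ?_⟩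
  obtain ⟨e2, e1⟩ := A6' b
  have eC : ∀ (n : ℕ) (c : ℝ), coeff (n+1) (C c) = 0 := fun n c => by simp [coeff_C]
  have eX : ∀ (n : ℕ), coeff (n+2) (X : PowerSeries ℝ) = 0 := fun n => by simp [coeff_X]
  ext n
  match n with
  | 0 =>
    simp [h0]; ring
  | 1 =>
    rw [show (1:ℕ) = 0+1 by rfl] at *
    simp only [map_add, map_sub, coeff_C_mul, coeff_succ_X_mul, eC, e1, coeff_mk]
    simp [h0]
    ring
  | 2 =>
    have e3 : coeff 1 (PowerSeries.mk b ^ 3) = 3 * b 0 ^ 2 * b 1 := by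
      have := A3 b 0
      rw [zero_add, hT, ← map_pow, eC 0] at this
      linarith
    rw [show (2:ℕ) = 0+1+1 by rfl] at *
    simp only [map_add, map_sub, coeff_C_mul, coeff_succ_X_mul, eC, e2, coeff_mk]
    simp [h0, h1, e3, coeff_X]
    ring
  | k+3 =>
    have := hb (k+1)
    rw [A3, A4, A6] at this
    simp only [map_add, map_sub, coeff_C_mul, coeff_succ_X_mul, eC, eX, coeff_mk]
    rw [h0, h1] at this
    ring_nf at this ⊢
    linarith

/-- formal fixed point equation -/
lemma formalV (M N : ℝ) (b : ℕ → ℝ) (h0 : b 0 = M)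
    (hb : ∀ m, b (m+1) = N * coeff (m+1) (T b (m+1) ^ 3) + N * coeff m (T b (m+1) ^ 4)
      + N * coeff (m+2) (T b (m+1) ^ 6)) (V U A : PowerSeries ℝ)
    (hV : V = PowerSeries.mk (fun i => b (i+2))) (hU : U = C (N * M^4) + X * V)
    (hA : A = C M + X * U) :
    V = C N * U * (A^3 + C M * A^2 + C (M^2) * A + C (M^3)) + C N * U^2 * (A + C (2*M))
      + C (15*N*M^4) * (X * (V * V))
      + C N * U^3 * (A^3 + C (3*M)*A^2 + C (6*M^2)*A + C (10*M^3)) := by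
  obtain ⟨h1, h⟩ := formal M N b h0 hb
  have hs : PowerSeries.mk b = A := by
    rw [split b 2, hA, hU, hV]
    simp only [T, Finset.sum_range_succ, Finset.sum_range_zero, h0, h1, monomial_eq_C_mul_X_pow]
    ring
  rw [hs] at h
  have hX : (X : PowerSeries ℝ)^3 ≠ 0 := pow_ne_zero _ X_ne_zero
  apply mul_left_cancel₀ hX
  simp only [map_mul, map_pow, map_ofNat] at h hU ⊢
  subst hA
  subst hU
  linear_combination h

/-- partial-sum bound -/
def P (t : ℝ) (n : ℕ) (F : PowerSeries ℝ) (x : ℝ) : Prop :=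
  (∀ i, 0 ≤ coeff i F) ∧ ∑ i ∈ Finset.range n, coeff i F * t ^ i ≤ x

lemma P.add {t : ℝ} {n : ℕ} {F G : PowerSeries ℝ} {x y : ℝ} (hF : P t n F x) (hG : P t n G y) :
    P t n (F + G) (x + y) := by
  refine ⟨fun i => by simpa using add_nonneg (hF.1 i) (hG.1 i), ?_⟩
  simp only [map_add, add_mul, Finset.sum_add_distrib]
  exact add_le_add hF.2 hG.2

lemma P.const {t : ℝ} (n : ℕ) {c : ℝ} (hc : 0 ≤ c) : P t n (C c) c := by
  refine ⟨fun i => by rw [coeff_C]; split_ifs <;> simp [hc], ?_⟩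
  cases n with
  | zero => simpa using hc
  | succ n => rw [Finset.sum_range_succ']; simp [coeff_C]

lemma P.mul {t : ℝ} (ht : 0 ≤ t) {n : ℕ} {F G : PowerSeries ℝ} {x y : ℝ} (hF : P t n F x)
    (hG : P t n G y) : P t n (F * G) (x * y) := by
  refine ⟨fun i => ?_, ?_⟩
  · rw [coeff_mul]
    exact Finset.sum_nonneg fun p _ => mul_nonneg (hF.1 _) (hG.1 _)
  · have hx : 0 ≤ x := le_trans (Finset.sum_nonneg fun i _ =>
      mul_nonneg (hF.1 i) (pow_nonneg ht i)) hF.2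
    refine le_trans ?_ (mul_le_mul hF.2 hG.2 (Finset.sum_nonneg fun i _ =>
      mul_nonneg (hG.1 i) (pow_nonneg ht i)) hx)
    rw [Finset.sum_mul_sum, ← Finset.sum_product']
    have : ∀ i ∈ Finset.range n, coeff i (F * G) * t ^ i =
        ∑ p ∈ (Finset.range n ×ˢ Finset.range n).filter (fun p => p.1 + p.2 = i),
          coeff p.1 F * t ^ p.1 * (coeff p.2 G * t ^ p.2) := by
      intro i hi
      rw [coeff_mul, Finset.sum_mul]
      have hh : (Finset.range n ×ˢ Finset.range n).filter (fun p => p.1 + p.2 = i)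
          = Finset.HasAntidiagonal.antidiagonal i := by
        ext p
        simp only [Finset.mem_filter, Finset.mem_product, Finset.mem_range,
          Finset.HasAntidiagonal.mem_antidiagonal] at hi ⊢
        omega
      rw [hh]
      refine Finset.sum_congr rfl fun p hp => ?_
      rw [← Finset.HasAntidiagonal.mem_antidiagonal.mp hp, pow_add]; ring
    rw [Finset.sum_congr rfl this]
    simp only [Finset.sum_filter]
    rw [Finset.sum_comm]
    refine Finset.sum_le_sum fun p _ => ?_
    have h0 : 0 ≤ coeff p.1 F * t ^ p.1 * (coeff p.2 G * t ^ p.2) :=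
      mul_nonneg (mul_nonneg (hF.1 _) (pow_nonneg ht _)) (mul_nonneg (hG.1 _) (pow_nonneg ht _))
    rw [Finset.sum_ite_eq]
    split_ifs
    · exact le_rfl
    · exact h0

lemma P.pow {t : ℝ} (ht : 0 ≤ t) {n : ℕ} {F : PowerSeries ℝ} {x : ℝ} (hF : P t n F x) (k : ℕ) :
    P t n (F ^ k) (x ^ k) := by
  induction k with
  | zero => simpa using P.const (t := t) n (zero_le_one)
  | succ k ih => rw [pow_succ, pow_succ]; exact ih.mul ht hF

lemma P.shift {t : ℝ} (ht : 0 ≤ t) {n : ℕ} {F : PowerSeries ℝ} {x : ℝ} (hF : P t n F x) :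
    P t (n+1) (X * F) (t * x) := by
  refine ⟨fun i => ?_, ?_⟩
  · cases i with
    | zero => simp
    | succ i => rw [coeff_succ_X_mul]; exact hF.1 i
  · rw [Finset.sum_range_succ']
    simp only [coeff_succ_X_mul]
    have : ∑ i ∈ Finset.range n, coeff i F * t ^ (i+1)
        = t * ∑ i ∈ Finset.range n, coeff i F * t ^ i := by
      rw [Finset.mul_sum]; exact Finset.sum_congr rfl fun i _ => by ring
    rw [this]
    simpa using mul_le_mul_of_nonneg_left hF.2 ht

/-- evaluation -/
def Ev (t : ℝ) (F : PowerSeries ℝ) (x : ℝ) : Prop :=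
  Summable (fun i => ‖coeff i F * t ^ i‖) ∧ HasSum (fun i => coeff i F * t ^ i) x

lemma Ev.add {t : ℝ} {F G : PowerSeries ℝ} {x y : ℝ} (hF : Ev t F x) (hG : Ev t G y) :
    Ev t (F + G) (x + y) := by
  refine ⟨?_, ?_⟩
  · refine Summable.of_nonneg_of_le (fun i => norm_nonneg _) (fun i => ?_) (hF.1.add hG.1)
    rw [map_add, add_mul]; exact norm_add_le _ _
  · simpa only [map_add, add_mul] using hF.2.add hG.2

lemma Ev.mul {t : ℝ} {F G : PowerSeries ℝ} {x y : ℝ} (hF : Ev t F x) (hG : Ev t G y) :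
    Ev t (F * G) (x * y) := by
  have e : (fun i => coeff i (F * G) * t ^ i) = fun n =>
      ∑ p ∈ Finset.HasAntidiagonal.antidiagonal n, coeff p.1 F * t ^ p.1 * (coeff p.2 G * t ^ p.2) := by
    ext n
    rw [coeff_mul, Finset.sum_mul]
    refine Finset.sum_congr rfl fun p hp => ?_
    rw [← Finset.HasAntidiagonal.mem_antidiagonal.mp hp, pow_add]; ring
  have s := summable_norm_sum_mul_antidiagonal_of_summable_norm hF.1 hG.1
  have v := tsum_mul_tsum_eq_tsum_sum_antidiagonal_of_summable_norm hF.1 hG.1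
  refine ⟨?_, ?_⟩
  · convert s using 2 with n
    exact congrArg norm (congrFun e n)
  · rw [e, ← hF.2.tsum_eq, ← hG.2.tsum_eq, v]
    exact s.of_norm.hasSum

lemma Ev.const (t c : ℝ) : Ev t (C c) c := by
  have h : ∀ i, i ≠ 0 → coeff i (C c) * t ^ i = 0 := fun i hi => by simp [coeff_C, hi]
  refine ⟨summable_of_ne_finset_zero (s := {0}) fun i hi => ?_, ?_⟩
  · rw [h i (by simpa using hi), norm_zero]
  · simpa using hasSum_single 0 h

lemma Ev.X (t : ℝ) : Ev t PowerSeries.X t := by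
  have h : ∀ i, i ≠ 1 → coeff i (PowerSeries.X : PowerSeries ℝ) * t ^ i = 0 :=
    fun i hi => by simp [coeff_X, hi]
  refine ⟨summable_of_ne_finset_zero (s := {1}) fun i hi => ?_, ?_⟩
  · rw [h i (by simpa using hi), norm_zero]
  · simpa using hasSum_single 1 h

lemma Ev.pow {t : ℝ} {F : PowerSeries ℝ} {x : ℝ} (hF : Ev t F x) (k : ℕ) :
    Ev t (F ^ k) (x ^ k) := by
  induction k with
  | zero => simpa using Ev.const t 1
  | succ k ih => rw [pow_succ, pow_succ]; exact ih.mul hF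

lemma Ev.sub {t : ℝ} {F G : PowerSeries ℝ} {x y : ℝ} (hF : Ev t F x) (hG : Ev t G y) :
    Ev t (F - G) (x - y) := by
  have h := hF.add ((Ev.const t (-1)).mul hG)
  have e : F + C (-1) * G = F - G := by simp [sub_eq_add_neg]
  rw [e] at h
  convert h using 1; ring

lemma exists_radius (M N : ℝ) (hM : 0 < M) (hN : 0 < N) (b : ℕ → ℝ) (h0 : b 0 = M)
    (hpos : ∀ m, 0 ≤ b m)
    (hb : ∀ m, b (m+1) = N * coeff (m+1) (T b (m+1) ^ 3) + N * coeff m (T b (m+1) ^ 4)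
      + N * coeff (m+2) (T b (m+1) ^ 6)) :
    ∃ ρ > 0, Summable (fun m => b m * ρ ^ m) := by
  let u : ℝ → ℝ → ℝ := fun K t => N * M^4 + t * K
  let A : ℝ → ℝ → ℝ := fun K t => M + t * u K t
  let G : ℝ → ℝ → ℝ := fun K t =>
    N * u K t * (A K t^3 + M * A K t^2 + (M^2) * A K t + (M^3)) + N * u K t^2 * (A K t + (2*M))
      + (15*N*M^4) * (t * (K * K))
      + N * u K t^3 * (A K t^3 + (3*M)*A K t^2 + (6*M^2)*A K t + (10*M^3))
  let K : ℝ := G 0 0 + 1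
  have hG0 : G K 0 < K := by
    have : G K 0 = G 0 0 := by simp [G, u, A]
    rw [this]; simp [K]
  have hK : 0 ≤ K := by simp only [K, G, u, A]; positivity
  have hc : Continuous (G K) := by simp only [G, u, A]; fun_prop
  have hev : ∀ᶠ t in 𝓝 (0:ℝ), G K t < K := hc.continuousAt.eventually_lt continuousAt_const hG0
  obtain ⟨t, htK, ht⟩ := ((hev.filter_mono nhdsWithin_le_nhds).and
    (self_mem_nhdsWithin : Ioi (0:ℝ) ∈ 𝓝[>] 0)).exists
  have ht' : 0 ≤ t := le_of_lt ht
  refine ⟨t, ht, ?_⟩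
  have key : ∀ n, P t n (PowerSeries.mk (fun i => b (i+2))) K := by
    intro n
    induction n with
    | zero => exact ⟨fun i => by simpa using hpos _, by simpa using hK⟩
    | succ n ih =>
      have hfix := formalV M N b h0 hb _ _ _ rfl rfl rfl
      set V := PowerSeries.mk (fun i => b (i+2)) with hV
      have hU : P t (n+1) (C (N * M^4) + X * V) (u K t) :=
        (P.const _ (by positivity)).add (ih.shift ht')
      have hU' : P t n (C (N * M^4) + X * V) (u K t) := by
        refine ⟨hU.1, le_trans ?_ hU.2⟩
        rw [Finset.sum_range_succ]
        have := mul_nonneg (hU.1 n) (pow_nonneg ht' n)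
        linarith
      have hA : P t (n+1) (C M + X * (C (N * M^4) + X * V)) (A K t) :=
        (P.const _ hM.le).add (hU'.shift ht')
      have c : ∀ x : ℝ, 0 ≤ x → P t (n+1) (C x) x := fun x hx => P.const _ hx
      have := (((((c N hN.le).mul ht' hU).mul ht' ((((hA.pow ht' 3).add
        ((c M hM.le).mul ht' (hA.pow ht' 2))).add ((c (M^2) (by positivity)).mul ht' hA)).add
        (c (M^3) (by positivity)))).add
        (((c N hN.le).mul ht' (hU.pow ht' 2)).mul ht' (hA.add (c (2*M) (by positivity))))).add
        ((c (15*N*M^4) (by positivity)).mul ht' ((ih.mul ht' ih).shift ht'))).add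
        (((c N hN.le).mul ht' (hU.pow ht' 3)).mul ht' ((((hA.pow ht' 3).add
        ((c (3*M) (by positivity)).mul ht' (hA.pow ht' 2))).add
        ((c (6*M^2) (by positivity)).mul ht' hA)).add
        (c (10*M^3) (by positivity))))
      rw [← hfix] at this
      exact ⟨this.1, this.2.trans htK.le⟩
  have hs : Summable (fun i => b (i+2) * t ^ i) :=
    summable_of_sum_range_le (c := K) (fun i => mul_nonneg (hpos _) (pow_nonneg ht' _))
      (fun n => by simpa using (key n).2)
  rw [← summable_nat_add_iff 2]
  refine (hs.mul_right (t^2)).congr fun i => ?_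
  rw [pow_add]; ring

end S15

/-- The Euclidean majorant sequence has a convergent exponential
generating series whose sum satisfies an explicit algebraic equation. -/
theorem stmt_15 (M N : ℝ) (hM : 0 < M) (hN : 0 < N) (a : ℕ → ℝ) (ha0 : a 0 = M)
    (ha : ∀ m : ℕ, 1 ≤ m → a m =
      N * multinom3Sum a m + N * (m : ℝ) * multinom4Sum a m
        + N / ((m : ℝ) + 1) * multinom6Sum a m) :
    ∃ ρ > (0 : ℝ), ∀ t : ℝ, |t| < ρ →
      Summable (fun m : ℕ => a m * t ^ m / (m.factorial : ℝ)) ∧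
      ((∑' m : ℕ, a m * t ^ m / (m.factorial : ℝ)) ^ 4 * N + 15 * M ^ 12 * N ^ 3) * t ^ 2
        - t * ((∑' m : ℕ, a m * t ^ m / (m.factorial : ℝ)) - M) *
            (1 - ((∑' m : ℕ, a m * t ^ m / (m.factorial : ℝ)) - M) *
                ((∑' m : ℕ, a m * t ^ m / (m.factorial : ℝ)) + 2 * M) * N
              + 30 * M ^ 8 * N ^ 2)
        + (∑' m : ℕ, a m * t ^ m / (m.factorial : ℝ)) ^ 6 * N
        - 6 * (∑' m : ℕ, a m * t ^ m / (m.factorial : ℝ)) * M ^ 5 * N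
        + 5 * M ^ 6 * N = 0 := by
  have hb := fun m => S15.recb N a m (ha (m+1) (by omega))
  have hpos := S15.nonneg_a M N hM hN a ha0 ha
  have h0 : (fun i => a i / (i.factorial : ℝ)) 0 = M := by simp [ha0]
  have hb0 : ∀ i, 0 ≤ a i / (i.factorial : ℝ) := fun i => by
    have := hpos i; positivity
  obtain ⟨ρ, hρ, hsum⟩ := S15.exists_radius M N hM hN (fun i => a i / (i.factorial : ℝ)) h0 hb0 hb
  have hrel := (S15.formal M N (fun i => a i / (i.factorial : ℝ)) h0 hb).2
  refine ⟨ρ, hρ, fun t ht => ?_⟩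
  have e : (fun m : ℕ => a m * t ^ m / (m.factorial : ℝ)) = fun i =>
      PowerSeries.coeff i (PowerSeries.mk (fun i => a i / (i.factorial : ℝ))) * t ^ i := by
    ext i; rw [PowerSeries.coeff_mk]; ring
  have hn : Summable (fun i =>
      ‖PowerSeries.coeff i (PowerSeries.mk (fun i => a i / (i.factorial : ℝ))) * t ^ i‖) := by
    refine Summable.of_nonneg_of_le (fun i => norm_nonneg _) (fun i => ?_) hsum
    rw [PowerSeries.coeff_mk, norm_mul, norm_pow, Real.norm_of_nonneg (hb0 i), Real.norm_eq_abs]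
    exact mul_le_mul_of_nonneg_left (pow_le_pow_left₀ (abs_nonneg t) ht.le i) (hb0 i)
  rw [e]
  refine ⟨hn.of_norm, ?_⟩
  have hA : S15.Ev t (PowerSeries.mk (fun i => a i / (i.factorial : ℝ))) _ :=
    ⟨hn, hn.of_norm.hasSum⟩
  generalize (∑' i, PowerSeries.coeff i
    (PowerSeries.mk (fun i => a i / (i.factorial : ℝ))) * t ^ i) = x at hA ⊢
  have hX := S15.Ev.X t
  have c := S15.Ev.const t
  have hL := hX.mul hA
  have hR := (((((((((((c M).mul hX).add ((c N).mul (hX.mul (hA.pow 3)))).add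
    ((c (2 * N * M^3)).mul hX)).sub ((c (3 * N * M^2)).mul (hX.mul hA))).add
    ((c N).mul (hX.mul (hX.mul (hA.pow 4))))).add ((c N).mul (hA.pow 6))).sub
    ((c (6 * N * M^5)).mul hA)).add (c (5 * N * M^6))).sub
    ((c (30 * N^2 * M^8)).mul (hX.mul hA))).add ((c (30 * N^2 * M^9)).mul hX)).add
    ((c (15 * N^3 * M^12)).mul (hX.mul hX))
  rw [← hrel] at hR
  have := hL.2.unique hR.2
  linear_combination -this

end
end

section
/- Let Ω ⊂ ℂ be a simply connected bounded domain, and let f⁰ : Ω → ℝ be a harmonic function whose Hessian matrix is nonzero at every point of Ω. Let g be a holomorphic function on Ω with 2·Re g = f⁰, let h′ be a continuous (hence holomorphic) branch of √(g″) on Ω (which exists since g″ is nonvanishing), and let h be an antiderivative of h′. Then the function f(w, t) = 2·Re g(w) + |h(w)|²·t + Re(h(w)²)·log|h′(w)|·t² satisfies, for each fixed w ∈ Ω, f_{ww̄}(w, t) − t·√( f_{ww}(w, t)·f_{w̄w̄}(w, t) ) = o(t²) as t → 0. -/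
open Set Filter Asymptotics
open scoped BigOperators Topology

noncomputable section

/-- Partial derivative in `x = Re w` of a complex-valued function of `w`. -/
def cpdx (g : ℂ → ℂ) (w : ℂ) : ℂ :=
  deriv (fun x : ℝ => g ((x : ℂ) + (w.im : ℂ) * Complex.I)) w.re

/-- Partial derivative in `y = Im w` of a complex-valued function of `w`. -/
def cpdy (g : ℂ → ℂ) (w : ℂ) : ℂ :=
  deriv (fun y : ℝ => g ((w.re : ℂ) + (y : ℂ) * Complex.I)) w.im

/-- The Wirtinger derivative `∂/∂w = (∂/∂x - i ∂/∂y)/2`. -/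
def wD (g : ℂ → ℂ) : ℂ → ℂ := fun w => (cpdx g w - Complex.I * cpdy g w) / 2

/-- The conjugate Wirtinger derivative `∂/∂w̄ = (∂/∂x + i ∂/∂y)/2`. -/
def wDbar (g : ℂ → ℂ) : ℂ → ℂ := fun w => (cpdx g w + Complex.I * cpdy g w) / 2

/-- A real-valued function viewed as a complex-valued one. -/
def cplx (f : ℂ → ℝ) : ℂ → ℂ := fun w => (f w : ℂ)

/-- `f_ww` for a real-valued function `f`. -/
def fww (f : ℂ → ℝ) : ℂ → ℂ := wD (wD (cplx f))

/-- `f_ww̄` for a real-valued function `f`. -/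
def fwwbar (f : ℂ → ℝ) : ℂ → ℂ := wDbar (wD (cplx f))

/-- `f_w̄w̄` for a real-valued function `f`. -/
def fwbarwbar (f : ℂ → ℝ) : ℂ → ℂ := wDbar (wDbar (cplx f))

/-- Partial derivative in `x = Re w` of a real-valued function of `w`. -/
def rpdx (f : ℂ → ℝ) (w : ℂ) : ℝ :=
  deriv (fun x : ℝ => f ((x : ℂ) + (w.im : ℂ) * Complex.I)) w.re

/-- Partial derivative in `y = Im w` of a real-valued function of `w`. -/
def rpdy (f : ℂ → ℝ) (w : ℂ) : ℝ :=
  deriv (fun y : ℝ => f ((w.re : ℂ) + (y : ℂ) * Complex.I)) w.im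

/-- real-differentiability with Wirtinger derivatives `a`, `b` -/
def HasW (f : ℂ → ℂ) (a b : ℂ) (w : ℂ) : Prop :=
  HasFDerivAt (𝕜 := ℝ) f
    (a • (ContinuousLinearMap.id ℝ ℂ) + b • (Complex.conjCLE : ℂ →L[ℝ] ℂ)) w

theorem HasW.cpd {f : ℂ → ℂ} {a b w : ℂ} (H : HasW f a b w) :
    cpdx f w = a + b ∧ cpdy f w = a * Complex.I - b * Complex.I := by
  have e : (w.re : ℂ) + (w.im : ℂ) * Complex.I = w := Complex.re_add_im w
  constructor
  · have h1 : HasDerivAt (fun x : ℝ => (x : ℂ) + (w.im : ℂ) * Complex.I) 1 w.re :=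
      (Complex.ofRealCLM.hasDerivAt (x := w.re)).add_const _
    unfold HasW at H
    rw [← e] at H
    have := (HasFDerivAt.comp_hasDerivAt w.re H h1).deriv
    simpa [cpdx, Function.comp_def] using this
  · have h1 : HasDerivAt (fun y : ℝ => (w.re : ℂ) + (y : ℂ) * Complex.I) Complex.I w.im := by
      simpa using ((Complex.ofRealCLM.hasDerivAt (x := w.im)).mul_const Complex.I).const_add
        (w.re : ℂ)
    unfold HasW at H
    rw [← e] at H
    have := (HasFDerivAt.comp_hasDerivAt w.im H h1).deriv
    simpa [cpdy, Function.comp_def, sub_eq_add_neg] using this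

theorem HasW.wD {f : ℂ → ℂ} {a b w : ℂ} (H : HasW f a b w) : wD f w = a := by
  have := H.cpd
  simp only [_root_.wD, this.1, this.2]
  linear_combination (-(a - b) / 2) * Complex.I_mul_I

theorem HasW.wDbar {f : ℂ → ℂ} {a b w : ℂ} (H : HasW f a b w) : wDbar f w = b := by
  have := H.cpd
  simp only [_root_.wDbar, this.1, this.2]
  linear_combination ((a - b) / 2) * Complex.I_mul_I

theorem HasW.congr {f k : ℂ → ℂ} {a b w : ℂ} (H : HasW f a b w) (e : k =ᶠ[𝓝 w] f) :
    HasW k a b w := HasFDerivAt.congr_of_eventuallyEq H e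

theorem HasW.cast {f : ℂ → ℂ} {a b a' b' w : ℂ} (H : HasW f a b w) (ha : a' = a)
    (hb : b' = b) : HasW f a' b' w := by subst ha hb; exact H

theorem HasW.add {f k : ℂ → ℂ} {a b c d w : ℂ} (H : HasW f a b w) (K : HasW k c d w) :
    HasW (fun z => f z + k z) (a + c) (b + d) w := by
  refine (HasFDerivAt.add H K).congr_fderiv ?_
  apply ContinuousLinearMap.ext
  intro v
  simp
  ring

theorem HasW.mul {f k : ℂ → ℂ} {a b c d w : ℂ} (H : HasW f a b w) (K : HasW k c d w) :
    HasW (fun z => f z * k z) (a * k w + f w * c) (b * k w + f w * d) w := by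
  refine (HasFDerivAt.mul H K).congr_fderiv ?_
  apply ContinuousLinearMap.ext
  intro v
  simp
  ring

theorem HasW.conj {f : ℂ → ℂ} {a b w : ℂ} (H : HasW f a b w) :
    HasW (fun z => (starRingEnd ℂ) (f z)) ((starRingEnd ℂ) b) ((starRingEnd ℂ) a) w := by
  have := (Complex.conjCLE : ℂ →L[ℝ] ℂ).hasFDerivAt.comp w H
  refine HasFDerivAt.congr_fderiv this ?_
  apply ContinuousLinearMap.ext
  intro v
  simp
  ring

theorem HasW.const (c w : ℂ) : HasW (fun _ => c) 0 0 w := by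
  refine (hasFDerivAt_const c w).congr_fderiv ?_
  apply ContinuousLinearMap.ext
  intro v
  simp

theorem HasW.of_hol {f : ℂ → ℂ} {a w : ℂ} (H : HasDerivAt f a w) : HasW f a 0 w := by
  refine (H.hasFDerivAt.restrictScalars ℝ).congr_fderiv ?_
  apply ContinuousLinearMap.ext
  intro v
  simp [mul_comm]

theorem HasW.comp_hol {f φ : ℂ → ℂ} {a b c w : ℂ} (H : HasW f a b w)
    (K : HasDerivAt φ c (f w)) : HasW (fun z => φ (f z)) (c * a) (c * b) w := by
  refine (((K.hasFDerivAt.restrictScalars ℝ)).comp w H).congr_fderiv ?_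
  apply ContinuousLinearMap.ext
  intro v
  simp
  ring

theorem rpd_of {f : ℂ → ℝ} {φ : ℂ → ℂ} {c w : ℂ} (e : f =ᶠ[𝓝 w] fun z => (φ z).re)
    (H : HasDerivAt φ c w) : rpdx f w = c.re ∧ rpdy f w = (c * Complex.I).re := by
  have ew : (w.re : ℂ) + (w.im : ℂ) * Complex.I = w := Complex.re_add_im w
  have H1 : HasFDerivAt (𝕜 := ℝ) f _ w := HasFDerivAt.congr_of_eventuallyEq
    (Complex.reCLM.hasFDerivAt.comp w (H.hasFDerivAt.restrictScalars ℝ)) e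
  rw [← ew] at H1
  constructor
  · have h1 : HasDerivAt (fun x : ℝ => (x : ℂ) + (w.im : ℂ) * Complex.I) 1 w.re :=
      (Complex.ofRealCLM.hasDerivAt (x := w.re)).add_const _
    have := (HasFDerivAt.comp_hasDerivAt w.re H1 h1).deriv
    simpa [rpdx, Function.comp_def] using this
  · have h1 : HasDerivAt (fun y : ℝ => (w.re : ℂ) + (y : ℂ) * Complex.I) Complex.I w.im := by
      simpa using ((Complex.ofRealCLM.hasDerivAt (x := w.im)).mul_const Complex.I).const_add
        (w.re : ℂ)
    have := (HasFDerivAt.comp_hasDerivAt w.im H1 h1).deriv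
    simpa [rpdy, Function.comp_def] using this

theorem norm_curve (a b P : ℂ) (ha : a ≠ 0) :
    HasDerivAt (fun t : ℝ => ‖a + t * b + t ^ 2 * P‖) ((b * (starRingEnd ℂ) a).re / ‖a‖) 0 := by
  have h1 : HasDerivAt (fun t : ℝ => a + t * b + t ^ 2 * P) b 0 := by
    have h0 : HasDerivAt (fun t : ℝ => (t : ℂ)) 1 0 := Complex.ofRealCLM.hasDerivAt
    have := ((h0.mul_const b).const_add a).add ((h0.pow 2).mul_const P)
    refine (this.congr_deriv ?_)
    simp
  have h2 := h1.norm_sq.sqrt (by simpa using ha)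
  simp only [Real.sqrt_sq (norm_nonneg _)] at h2
  convert h2 using 1
  simp [Complex.inner]
  field_simp

theorem final_o (a b P : ℂ) (ha : a ≠ 0) :
    (fun t : ℝ => ((t * ‖a‖ + t ^ 2 * ((b * (starRingEnd ℂ) a).re / ‖a‖)
      - t * ‖a + t * b + t ^ 2 * P‖ : ℝ) : ℂ)) =o[𝓝 (0 : ℝ)] (fun t : ℝ => t ^ 2) := by
  have h1 := (hasDerivAt_iff_isLittleO.1 (norm_curve a b P ha))
  have h2 := ((isBigO_refl (fun t : ℝ => t) (𝓝 0)).mul_isLittleO h1).neg_left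
  rw [← isLittleO_norm_left] at h2 ⊢
  refine (h2.congr ?_ ?_)
  · intro t
    rw [Complex.norm_real]
    congr 1
    simp
    ring
  · intro t; simp; ring

/-- The explicit second-order approximation of an isotropic CRPC
surface: `f(w,t) = 2 Re g + |h|² t + Re(h²) log|h′| t²` satisfies the complex isotropic
CRPC equation up to `o(t²)`. -/
theorem stmt_18 (Ω : Set ℂ) (hΩo : IsOpen Ω) (hΩc : IsConnected Ω)
    (hΩb : Bornology.IsBounded Ω) (hΩsc : SimplyConnectedSpace Ω)
    (f0 : ℂ → ℝ)
    (hharm : ∀ w ∈ Ω, rpdx (rpdx f0) w + rpdy (rpdy f0) w = 0)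
    (hhess : ∀ w ∈ Ω,
      ¬(rpdx (rpdx f0) w = 0 ∧ rpdy (rpdx f0) w = 0 ∧ rpdy (rpdy f0) w = 0))
    (g : ℂ → ℂ) (hg : DifferentiableOn ℂ g Ω)
    (hgre : ∀ w ∈ Ω, 2 * (g w).re = f0 w)
    (h' : ℂ → ℂ) (hh'c : ContinuousOn h' Ω)
    (hh'sq : ∀ w ∈ Ω, (h' w) ^ 2 = deriv (deriv g) w)
    (h : ℂ → ℂ) (hh : ∀ w ∈ Ω, HasDerivAt h (h' w) w)
    (F : ℝ → ℂ → ℝ)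
    (hF : ∀ t w, F t w = 2 * (g w).re + ‖h w‖ ^ 2 * t
        + ((h w) ^ 2).re * Real.log ‖h' w‖ * t ^ 2) :
    ∀ w ∈ Ω,
      (fun t : ℝ => fwwbar (F t) w
          - (t : ℂ) * (Real.sqrt ((fww (F t) w * fwbarwbar (F t) w).re) : ℂ))
        =o[𝓝 (0 : ℝ)] (fun t : ℝ => t ^ 2) := by
  intro w hw
  have hgd : DifferentiableOn ℂ (deriv g) Ω := hg.deriv hΩo
  have hg1 : ∀ z ∈ Ω, HasDerivAt g (deriv g z) z := fun z hz =>
    (hg.differentiableAt (hΩo.mem_nhds hz)).hasDerivAt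
  have hg2 : ∀ z ∈ Ω, HasDerivAt (deriv g) (h' z ^ 2) z := fun z hz => by
    rw [hh'sq z hz]
    exact (hgd.differentiableAt (hΩo.mem_nhds hz)).hasDerivAt
  have hhd : DifferentiableOn ℂ h Ω := fun z hz => (hh z hz).differentiableAt.differentiableWithinAt
  have hpd : DifferentiableOn ℂ h' Ω :=
    (hhd.deriv hΩo).congr fun z hz => (hh z hz).deriv.symm
  have hp1 : ∀ z ∈ Ω, HasDerivAt h' (deriv h' z) z := fun z hz =>
    (hpd.differentiableAt (hΩo.mem_nhds hz)).hasDerivAt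
  have hqd : DifferentiableOn ℂ (deriv h') Ω := hpd.deriv hΩo
  have hne : ∀ z ∈ Ω, h' z ≠ 0 := by
    intro z hz h0
    have A : ∀ y ∈ Ω, rpdx f0 y = (2 * deriv g y).re ∧
        rpdy f0 y = (2 * deriv g y * Complex.I).re := by
      intro y hy
      refine rpd_of (φ := fun x => 2 * g x) ?_ ((hg1 y hy).const_mul 2)
      filter_upwards [hΩo.mem_nhds hy] with x hx
      rw [← hgre x hx]; simp
    have B := rpd_of (f := rpdx f0) (φ := fun x => 2 * deriv g x) (w := z)
      (by filter_upwards [hΩo.mem_nhds hz] with x hx using (A x hx).1) ((hg2 z hz).const_mul 2)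
    have C := rpd_of (f := rpdy f0) (φ := fun x => 2 * deriv g x * Complex.I) (w := z)
      (by filter_upwards [hΩo.mem_nhds hz] with x hx using (A x hx).2)
      (((hg2 z hz).const_mul 2).mul_const Complex.I)
    apply hhess z hz
    rw [B.1, B.2, C.2, h0]
    simp
  have hl : ∀ z ∈ Ω, HasW (fun z => Complex.log (h' z * (starRingEnd ℂ) (h' z)) / 2)
      (deriv h' z / h' z / 2) ((starRingEnd ℂ) (deriv h' z / h' z) / 2) z := by
    intro z hz
    have h0 := hne z hz
    have h0' : (starRingEnd ℂ) (h' z) ≠ 0 := by simpa using h0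
    have H := HasW.of_hol (hp1 z hz)
    have hs : h' z * (starRingEnd ℂ) (h' z) ∈ Complex.slitPlane := by
      rw [Complex.mul_conj]
      exact Complex.ofReal_mem_slitPlane.2 (Complex.normSq_pos.2 h0)
    refine ((H.mul H.conj).comp_hol ((Complex.hasDerivAt_log hs).div_const 2)).cast ?_ ?_
    · simp; field_simp
    · simp; field_simp
  have e1 : ∀ t : ℝ, cplx (F t) = fun z => (g z + (starRingEnd ℂ) (g z))
      + (t : ℂ) * (h z * (starRingEnd ℂ) (h z))
      + ((t : ℂ) ^ 2 / 2) * ((h z * h z + (starRingEnd ℂ) (h z * h z))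
        * (Complex.log (h' z * (starRingEnd ℂ) (h' z)) / 2)) := by
    intro t
    ext z
    have a1 : Complex.log (h' z * (starRingEnd ℂ) (h' z)) = 2 * (Real.log ‖h' z‖ : ℂ) := by
      rw [Complex.mul_conj, Complex.normSq_eq_norm_sq, ← Complex.ofReal_log (by positivity),
        Real.log_pow]
      push_cast; ring
    rw [a1, Complex.add_conj, Complex.add_conj, Complex.mul_conj, Complex.normSq_eq_norm_sq]
    simp only [cplx, hF]
    push_cast
    rw [← sq (h z)]
    ring
  have W1 : ∀ t : ℝ, ∀ z ∈ Ω, ∃ a, a = deriv g z + (t : ℂ) * (h' z * (starRingEnd ℂ) (h z))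
      + ((t : ℂ) ^ 2 / 2) * ((2 * (h z * h' z)) *
            (Complex.log (h' z * (starRingEnd ℂ) (h' z)) / 2)
          + (h z * h z + (starRingEnd ℂ) (h z * h z)) * (deriv h' z / h' z / 2)) ∧
      HasW (cplx (F t)) a ((starRingEnd ℂ) a) z := by
    intro t z hz
    refine ⟨_, rfl, ?_⟩
    rw [e1]
    have G := HasW.of_hol (hg1 z hz)
    have H := HasW.of_hol (hh z hz)
    have HH := H.mul H
    refine (((G.add G.conj).add ((HasW.const (t : ℂ) z).mul (H.mul H.conj))).add
      ((HasW.const ((t : ℂ) ^ 2 / 2) z).mul ((HH.add HH.conj).mul (hl z hz)))).cast ?_ ?_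
    · simp only [map_add, map_mul, map_div₀, map_pow, map_zero, map_ofNat, Complex.conj_ofReal, Complex.conj_conj]
      ring
    · have a1 : (starRingEnd ℂ) (Complex.log (h' z * (starRingEnd ℂ) (h' z)))
          = Complex.log (h' z * (starRingEnd ℂ) (h' z)) := by
        rw [Complex.mul_conj, ← Complex.ofReal_log (Complex.normSq_nonneg _), Complex.conj_ofReal]
      set Lg := Complex.log (h' z * (starRingEnd ℂ) (h' z)) with hLg
      simp only [map_add, map_mul, map_div₀, map_pow, map_zero, map_ofNat, Complex.conj_ofReal, Complex.conj_conj, a1]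
      ring
  obtain ⟨P, W2⟩ : ∃ P : ℂ, ∀ t : ℝ, HasW (wD (cplx (F t)))
      (h' w ^ 2 + t * (deriv h' w * (starRingEnd ℂ) (h w)) + t ^ 2 * P)
      (t * (h' w * (starRingEnd ℂ) (h' w)) + t ^ 2 / 2 *
        (h w * h' w * (starRingEnd ℂ) (deriv h' w / h' w)
        + (starRingEnd ℂ) (h w * h' w) * (deriv h' w / h' w))) w := by
    have G := HasW.of_hol (hg2 w hw)
    have H := HasW.of_hol (hh w hw)
    have K := HasW.of_hol (hp1 w hw)
    have HH := H.mul H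
    have Q := HasW.of_hol (((hqd.differentiableAt (hΩo.mem_nhds hw)).div
      (hpd.differentiableAt (hΩo.mem_nhds hw)) (hne w hw)).hasDerivAt.div_const 2)
    have T := (((HasW.const 2 w).mul (H.mul K)).mul (hl w hw)).add ((HH.add HH.conj).mul Q)
    refine ⟨?_, fun t => ?_⟩
    rotate_left
    · refine HasW.congr (((G.add ((HasW.const (t : ℂ) w).mul (K.mul H.conj))).add
        ((HasW.const ((t : ℂ) ^ 2 / 2) w).mul T)).cast ?_ ?_) ?_
      rotate_left 2
      · filter_upwards [hΩo.mem_nhds hw] with z hz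
        obtain ⟨a, ha, hW⟩ := W1 t z hz
        rw [hW.wD, ha]
        rfl
      · simp only [zero_mul, zero_add, map_zero, mul_zero, add_zero]
        rw [div_mul_eq_mul_div, mul_div_assoc]
      · simp only [map_add, map_mul, map_div₀, map_pow, map_zero, map_ofNat, Complex.conj_ofReal, Complex.conj_conj, Pi.div_apply]
        ring
  have E3 : ∀ t : ℝ, fwbarwbar (F t) w = (starRingEnd ℂ) (fww (F t) w) := by
    intro t
    have : wDbar (cplx (F t)) =ᶠ[𝓝 w] fun z => (starRingEnd ℂ) (wD (cplx (F t)) z) := by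
      filter_upwards [hΩo.mem_nhds hw] with z hz
      obtain ⟨a, ha, hW⟩ := W1 t z hz
      rw [hW.wD, hW.wDbar]
    rw [fwbarwbar, ((W2 t).conj.congr this).wDbar, fww, (W2 t).wD]
  have h0 := hne w hw
  have key := final_o (h' w ^ 2) (deriv h' w * (starRingEnd ℂ) (h w)) P (pow_ne_zero 2 h0)
  refine key.congr_left ?_
  intro t
  rw [E3, Complex.mul_conj, Complex.ofReal_re, Complex.normSq_eq_norm_sq,
    Real.sqrt_sq (norm_nonneg _), fww, (W2 t).wD, fwwbar, (W2 t).wDbar]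
  have h0' : (starRingEnd ℂ) (h' w) ≠ 0 := by simpa using h0
  have n2 : ((‖h' w ^ 2‖ : ℝ) : ℂ) = h' w * (starRingEnd ℂ) (h' w) := by
    rw [Complex.mul_conj, Complex.normSq_eq_norm_sq, norm_pow]
  push_cast [← n2]
  rw [Complex.re_eq_add_conj]
  push_cast at n2
  congr 2
  rw [← Complex.ofReal_pow, norm_pow] at *
  push_cast at *
  rw [n2]
  simp
  field_simp
  ring

end
end
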